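/- arXiv:math/9705222 — 10 statements merged into one kernel-verified Lean document; each statement's English description precedes it below -/
import Mathlib

section
/- Let G be a group and let g_1, …, g_k ∈ G be elements whose normal closure is all of G. Then the Milnor group M(G; g_1, …, g_k) is nilpotent, and its lower central series satisfies M(G; g_1, …, g_k)^{k+1} = 1; in particular M(G; g_1, …, g_k) is a quotient of G/G^{k+1}. -/
open scoped commutatorElement

/-- Relators of the Milnor group: `[g i, h⁻¹ * g i * h]` for all `i` and `h`. -/
def milnorRelators {G : Type*} [Group G] {ι : Type*} (g : ι → G) : Set G :=
  {x | ∃ (i : ι) (h : G), x = ⁅g i, h⁻¹ * g i * h⁆}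

/-- The Milnor group of `G` with respect to the elements `g i`: the quotient of `G`
by the normal closure of the Milnor relators. -/
abbrev MilnorGroup {G : Type*} [Group G] {ι : Type*} (g : ι → G) : Type _ :=
  G ⧸ Subgroup.normalClosure (milnorRelators g)

/-- The quotient map onto the Milnor group. -/
abbrev milnorQuot {G : Type*} [Group G] {ι : Type*} (g : ι → G) : G →* MilnorGroup g :=
  QuotientGroup.mk' _

/-- Commutators of two normal closures are controlled by conjugates of generators. -/
theorem milnor_commutator_normalClosure_le {M : Type*} [Group M] (X Y : Set M) (E : Subgroup M)
    [E.Normal]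
    (h : ∀ x ∈ X, ∀ y ∈ Y, ∀ c d : M, ⁅c * x * c⁻¹, d * y * d⁻¹⁆ ∈ E) :
    ⁅Subgroup.normalClosure X, Subgroup.normalClosure Y⁆ ≤ E := by
  have key : ∀ a b : M, ⁅a, b⁆ ∈ E ↔
      (QuotientGroup.mk' E b) * (QuotientGroup.mk' E a) =
        (QuotientGroup.mk' E a) * (QuotientGroup.mk' E b) := by
    intro a b
    rw [← QuotientGroup.eq_one_iff (N := E), ← QuotientGroup.mk'_apply, map_commutatorElement,
      commutatorElement_eq_one_iff_mul_comm, eq_comm]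
  have h1 : Subgroup.normalClosure X ≤ (Subgroup.centralizer
      (QuotientGroup.mk' E '' Group.conjugatesOfSet Y)).comap (QuotientGroup.mk' E) := by
    unfold Subgroup.normalClosure
    rw [Subgroup.closure_le]
    intro a ha
    simp only [Group.mem_conjugatesOfSet_iff, isConj_iff] at ha
    obtain ⟨x, hx, c, rfl⟩ := ha
    rw [SetLike.mem_coe, Subgroup.mem_comap, Subgroup.mem_centralizer_iff]
    rintro _ ⟨b, hb, rfl⟩
    simp only [Group.mem_conjugatesOfSet_iff, isConj_iff] at hb
    obtain ⟨y, hy, d, rfl⟩ := hb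
    exact (key _ _).1 (h x hx y hy c d)
  have h2 : Subgroup.normalClosure Y ≤ (Subgroup.centralizer
      (QuotientGroup.mk' E '' (Subgroup.normalClosure X : Set M))).comap (QuotientGroup.mk' E) := by
    conv_lhs => unfold Subgroup.normalClosure
    rw [Subgroup.closure_le]
    intro b hb
    rw [SetLike.mem_coe, Subgroup.mem_comap, Subgroup.mem_centralizer_iff]
    rintro _ ⟨a, ha, rfl⟩
    have := h1 ha
    rw [Subgroup.mem_comap, Subgroup.mem_centralizer_iff] at this
    exact (this _ ⟨b, hb, rfl⟩).symm
  rw [Subgroup.commutator_le]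
  intro a ha b hb
  have := h2 hb
  rw [Subgroup.mem_comap, Subgroup.mem_centralizer_iff] at this
  exact (key _ _).2 (this _ ⟨a, ha, rfl⟩).symm

/-- A group generated by `k` normal abelian subgroups has class at most `k`. -/
theorem milnor_lcs_aux {M : Type*} [Group M] {k : ℕ} (g : Fin k → M)
    (hg : Subgroup.normalClosure (Set.range g) = ⊤)
    (hc : ∀ i (h : M), ⁅g i, h⁻¹ * g i * h⁆ = 1) :
    (⊤ : Subgroup M).lowerCentralSeries k = ⊥ := by
  have hab : ∀ i, ⁅Subgroup.normalClosure {g i}, Subgroup.normalClosure {g i}⁆ ≤ ⊥ := by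
    intro i
    apply milnor_commutator_normalClosure_le
    rintro x rfl y rfl c d
    have := hc i (d⁻¹ * c)
    have h2 : ⁅c * g i * c⁻¹, d * g i * d⁻¹⁆ =
        c * ⁅g i, (d⁻¹ * c)⁻¹ * g i * (d⁻¹ * c)⁆ * c⁻¹ := by
      simp [commutatorElement_def, mul_assoc]
    rw [h2, this]
    simp
  let X : ℕ → Set M := fun n =>
    {x | ∃ S : Finset (Fin k), S.card = n + 1 ∧ ∀ i ∈ S, x ∈ Subgroup.normalClosure {g i}}
  have main : ∀ n, (⊤ : Subgroup M).lowerCentralSeries n ≤ Subgroup.normalClosure (X n) := by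
    intro n
    induction n with
    | zero =>
      rw [Subgroup.lowerCentralSeries_zero, ← hg]
      apply Subgroup.normalClosure_mono
      rintro _ ⟨i, rfl⟩
      refine ⟨{i}, by simp, ?_⟩
      intro j hj
      rw [Finset.mem_singleton] at hj
      subst hj
      exact Subgroup.subset_normalClosure (Set.mem_singleton _)
    | succ n ih =>
      rw [Subgroup.lowerCentralSeries_succ]
      refine (Subgroup.commutator_mono ih hg.ge).trans ?_
      apply milnor_commutator_normalClosure_le
      rintro x ⟨S, hS, hx⟩ _ ⟨j, rfl⟩ c d
      have hx' : ∀ i ∈ S, c * x * c⁻¹ ∈ Subgroup.normalClosure {g i} := fun i hi =>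
        Subgroup.normalClosure_normal.conj_mem _ (hx i hi) c
      have hy : d * g j * d⁻¹ ∈ Subgroup.normalClosure {g j} :=
        Subgroup.normalClosure_normal.conj_mem _ (Subgroup.subset_normalClosure (Set.mem_singleton _)) d
      by_cases hj : j ∈ S
      · have := hab j (Subgroup.commutator_mem_commutator (hx' j hj) hy)
        rw [Subgroup.mem_bot] at this
        rw [this]
        exact one_mem _
      · apply Subgroup.subset_normalClosure
        refine ⟨insert j S, by rw [Finset.card_insert_of_notMem hj, hS], ?_⟩
        intro i hi
        rcases Finset.mem_insert.1 hi with rfl | hi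
        · exact Subgroup.commutator_le_right ⊤ _
            (Subgroup.commutator_mem_commutator (Subgroup.mem_top _) hy)
        · exact Subgroup.commutator_le_left _ ⊤
            (Subgroup.commutator_mem_commutator (hx' i hi) (Subgroup.mem_top _))
  rw [eq_bot_iff]
  refine (main k).trans (Subgroup.normalClosure_le_normal ?_)
  rintro x ⟨S, hS, -⟩
  have := S.card_le_univ
  rw [hS, Fintype.card_fin] at this
  omega

/-- If `g 1, …, g k` normally generate `G`, then the Milnor group `M(G; g)` is nilpotent,
with `M(G; g)^{k+1} = 1`; in particular it is a quotient of `G/G^{k+1}`. -/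
theorem milnorGroup_nilpotent {G : Type*} [Group G] (k : ℕ) (g : Fin k → G)
    (hg : Subgroup.normalClosure (Set.range g) = ⊤) :
    Group.IsNilpotent (MilnorGroup g) ∧
    (⊤ : Subgroup (MilnorGroup g)).lowerCentralSeries k = ⊥ ∧
    ∃ φ : G ⧸ (⊤ : Subgroup G).lowerCentralSeries k →* MilnorGroup g,
      Function.Surjective φ ∧
      ∀ x : G, φ (QuotientGroup.mk x) = milnorQuot g x := by
  have hsurj : Function.Surjective (milnorQuot g) := QuotientGroup.mk'_surjective _
  have hl : (⊤ : Subgroup (MilnorGroup g)).lowerCentralSeries k = ⊥ := by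
    apply milnor_lcs_aux (fun i => milnorQuot g (g i))
    · have := Subgroup.map_normalClosure (Set.range g) (milnorQuot g) hsurj
      rw [hg, Subgroup.map_top_of_surjective _ hsurj, ← Set.range_comp] at this
      exact this.symm
    · intro i h
      obtain ⟨h, rfl⟩ := hsurj h
      rw [← map_inv, ← map_mul, ← map_mul, ← map_commutatorElement]
      exact (QuotientGroup.eq_one_iff _).2 (Subgroup.subset_normalClosure ⟨i, h, rfl⟩)
  refine ⟨Subgroup.nilpotent_iff_lowerCentralSeries.2 ⟨k, hl⟩, hl, ?_⟩
  have hker : (⊤ : Subgroup G).lowerCentralSeries k ≤ (milnorQuot g).ker := by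
    intro x hx
    have h1 := Subgroup.mem_map_of_mem (milnorQuot g) hx
    rw [Subgroup.map_lowerCentralSeries, Subgroup.map_top_of_surjective _ hsurj, hl] at h1
    exact h1
  refine ⟨QuotientGroup.lift _ (milnorQuot g) hker, ?_, fun x => rfl⟩
  intro y
  obtain ⟨x, rfl⟩ := hsurj y
  exact ⟨QuotientGroup.mk x, rfl⟩
end

section
/- Let G be a group and let g_1, …, g_k ∈ G be elements whose normal closure is all of G. Then the Milnor group M(G; g_1, …, g_k) is generated by the images of g_1, …, g_k under the quotient map G → M(G; g_1, …, g_k). -/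
open scoped commutatorElement

theorem milnor_aux {M : Type*} [Group M] (s : Set M) (hs : s.Finite) :
    (∀ a ∈ s, ∀ h : M, Commute a (h * a * h⁻¹)) →
    ∀ N : Subgroup M, N.Normal → Subgroup.normalClosure s ⊔ N = ⊤ →
      Subgroup.closure s ⊔ N = ⊤ := by
  induction s, hs using Set.Finite.induction_on with
  | empty =>
    intro _ N hN h
    have h0 : Subgroup.normalClosure (∅ : Set M) ≤ N :=
      Subgroup.normalClosure_le_normal (Set.empty_subset _)
    have : N = ⊤ := by rw [← h]; exact (sup_eq_right.mpr h0).symm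
    rw [this, sup_top_eq]
  | @insert a s _ _ ih =>
    intro hc N hN h
    have hA : (Subgroup.normalClosure {a} ⊔ N).Normal := inferInstance
    have h1 := ih (fun b hb => hc b (Set.mem_insert_of_mem _ hb))
      (Subgroup.normalClosure {a} ⊔ N) hA (by
        rw [eq_top_iff, ← h]
        refine sup_le ?_ (le_sup_of_le_right le_sup_right)
        refine Subgroup.normalClosure_le_normal ?_
        rintro x (rfl | hx)
        · exact Subgroup.mem_sup_right (Subgroup.mem_sup_left
            (Subgroup.subset_normalClosure rfl))
        · exact Subgroup.mem_sup_left (Subgroup.subset_normalClosure hx))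
    have hcen : ∀ n ∈ Subgroup.normalClosure {a}, a * n = n * a := by
      have : Subgroup.normalClosure {a} ≤ Subgroup.centralizer {a} := by
        refine (Subgroup.closure_le _).mpr ?_
        intro x hx
        obtain ⟨b, hb, hx⟩ := Group.mem_conjugatesOfSet_iff.mp hx
        obtain ⟨c, rfl⟩ := isConj_iff.mp hx
        obtain rfl : b = a := hb
        rw [SetLike.mem_coe, Subgroup.mem_centralizer_singleton_iff]
        exact (hc b (Set.mem_insert _ _) c).eq.symm
      intro n hn
      exact (Subgroup.mem_centralizer_singleton_iff.mp (this hn)).symm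
    set K := Subgroup.closure (insert a s) ⊔ N with hK
    have hK0 : Subgroup.closure s ⊔ N ≤ K :=
      sup_le_sup_right (Subgroup.closure_mono (Set.subset_insert _ _)) _
    have haK : a ∈ K := Subgroup.mem_sup_left (Subgroup.subset_closure (Set.mem_insert _ _))
    have hnK : Subgroup.normalClosure {a} ≤ K := by
      refine (Subgroup.closure_le _).mpr ?_
      intro x hx
      obtain ⟨b, hb, hx⟩ := Group.mem_conjugatesOfSet_iff.mp hx
      obtain ⟨m, rfl⟩ := isConj_iff.mp hx
      obtain rfl : b = a := hb
      have hm : m ∈ (Subgroup.closure s ⊔ N) ⊔ Subgroup.normalClosure {b} := by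
        rw [sup_assoc, sup_comm N, h1]; trivial
      obtain ⟨y, hy, z, hz, rfl⟩ := Subgroup.mem_sup_of_normal_right.mp hm
      have : y * z * b * (y * z)⁻¹ = y * b * y⁻¹ := by
        rw [mul_assoc y z b, ← hcen z hz]; group
      rw [this]
      exact K.mul_mem (K.mul_mem (hK0 hy) haK) (K.inv_mem (hK0 hy))
    rw [eq_top_iff, ← h1]
    exact sup_le (le_sup_left.trans hK0) (sup_le hnK le_sup_right)

/-- If `g 1, …, g k` normally generate `G`, then the Milnor group `M(G; g)` is generated
by the images of the `g i` under the quotient map. -/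
theorem milnorGroup_generated_by_images {G : Type*} [Group G] (k : ℕ) (g : Fin k → G)
    (hg : Subgroup.normalClosure (Set.range g) = ⊤) :
    Subgroup.closure (Set.range fun i => milnorQuot g (g i)) = ⊤ := by
  have hsurj : Function.Surjective (milnorQuot g) := QuotientGroup.mk'_surjective _
  have key := milnor_aux (Set.range fun i => milnorQuot g (g i)) (Set.finite_range _) (by
    rintro _ ⟨i, rfl⟩ h
    obtain ⟨h, rfl⟩ := hsurj h
    have : milnorQuot g ⁅g i, h⁻¹⁻¹ * g i * h⁻¹⁆ = 1 :=
      (QuotientGroup.eq_one_iff _).mpr (Subgroup.subset_normalClosure ⟨i, h⁻¹, rfl⟩)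
    rw [map_commutatorElement, commutatorElement_eq_one_iff_commute, inv_inv, map_mul, map_mul,
      map_inv] at this
    exact this) ⊥ inferInstance (by
      rw [sup_bot_eq, Set.range_comp' (milnorQuot g) g,
        ← Subgroup.map_normalClosure _ _ hsurj, hg]
      exact Subgroup.map_top_of_surjective _ hsurj)
  rwa [sup_bot_eq] at key
end

section
/- The additive group of the ring R(y_1, …, y_s) is free abelian with basis the images of the monomials y_{j_1} ⋯ y_{j_r}, where (j_1, …, j_r) ranges over all finite duplicate-free lists of indices from {1, …, s} (the empty list giving the monomial 1). Formally: the family indexed by duplicate-free lists, sending a list to the image in R(y_1, …, y_s) of the corresponding product of generators, is a ℤ-basis of R(y_1, …, y_s). -/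
/-- Monomials in the free associative ℤ-algebra on `Fin s` in which some index occurs
at least twice. -/
def dupMonomials (s : ℕ) : Set (FreeAlgebra ℤ (Fin s)) :=
  {x | ∃ l : List (Fin s), ¬ l.Nodup ∧ x = (l.map (FreeAlgebra.ι ℤ)).prod}

/-- The relation whose ring-quotient kills the two-sided ideal generated by the
monomials with a repeated index. -/
def RRel (s : ℕ) : FreeAlgebra ℤ (Fin s) → FreeAlgebra ℤ (Fin s) → Prop :=
  fun a b => a ∈ dupMonomials s ∧ b = 0

/-- Milnor's ring `R(y_1, …, y_s)`. -/
abbrev RRing (s : ℕ) : Type := RingQuot (RRel s)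

/-- The image in `R(y_1, …, y_s)` of the monomial corresponding to a list of indices. -/
def RMonomial {s : ℕ} (l : List (Fin s)) : RRing s :=
  RingQuot.mkRingHom (RRel s) ((l.map (FreeAlgebra.ι ℤ)).prod)

open Classical in
/-- Left multiplication by a generator on the free module on duplicate-free lists. -/
noncomputable def RGenAct (s : ℕ) (i : Fin s) :
    Module.End ℤ ({l : List (Fin s) // l.Nodup} →₀ ℤ) :=
  Finsupp.lift _ ℤ _ fun m =>
    if h : (i :: m.val).Nodup then Finsupp.single ⟨i :: m.val, h⟩ (1 : ℤ) else 0

open Classical in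
theorem RGenAct_single (s : ℕ) (i : Fin s) (m : {l : List (Fin s) // l.Nodup}) :
    RGenAct s i (Finsupp.single m 1) =
      if h : (i :: m.val).Nodup then Finsupp.single ⟨i :: m.val, h⟩ (1 : ℤ) else 0 := by
  simp [RGenAct]

open Classical in
theorem RGenAct_prod {s : ℕ} (l : List (Fin s)) (m : {l : List (Fin s) // l.Nodup}) :
    (l.map (RGenAct s)).prod (Finsupp.single m 1) =
      if h : (l ++ m.val).Nodup then Finsupp.single ⟨l ++ m.val, h⟩ (1 : ℤ) else 0 := by
  induction l with
  | nil => simp [m.2]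
  | cons i l ih =>
    rw [List.map_cons, List.prod_cons, Module.End.mul_apply, ih]
    by_cases h : (l ++ m.val).Nodup
    · rw [dif_pos h, RGenAct_single]
      rfl
    · have h' : ¬ (i :: l ++ m.val).Nodup := fun h' => h (List.nodup_cons.1 h').2
      rw [dif_neg h, dif_neg h', map_zero]

/-- The representation of the free algebra by left multiplications. -/
noncomputable def RFreeAct (s : ℕ) :
    FreeAlgebra ℤ (Fin s) →+* Module.End ℤ ({l : List (Fin s) // l.Nodup} →₀ ℤ) :=
  (FreeAlgebra.lift ℤ (RGenAct s)).toRingHom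

theorem RFreeAct_prod {s : ℕ} (l : List (Fin s)) :
    RFreeAct s (l.map (FreeAlgebra.ι ℤ)).prod = (l.map (RGenAct s)).prod := by
  rw [map_list_prod, List.map_map]
  congr 1
  apply List.map_congr_left
  intro i _
  exact FreeAlgebra.lift_ι_apply _ _

theorem RFreeAct_rel {s : ℕ} ⦃a b : FreeAlgebra ℤ (Fin s)⦄ (h : RRel s a b) :
    RFreeAct s a = RFreeAct s b := by
  obtain ⟨⟨l, hl, rfl⟩, rfl⟩ := h
  rw [RFreeAct_prod, map_zero]
  refine Finsupp.lhom_ext' fun m => LinearMap.ext_ring ?_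
  have h' : ¬ (l ++ m.val).Nodup := fun h' => hl (List.nodup_append.1 h').1
  have := RGenAct_prod l m
  rw [dif_neg h'] at this
  simpa using this

/-- The coordinate map: act on the empty monomial. -/
noncomputable def RRing_coord (s : ℕ) : RRing s →ₗ[ℤ] ({l : List (Fin s) // l.Nodup} →₀ ℤ) :=
  AddMonoidHom.toIntLinearMap
    { toFun := fun x => RingQuot.lift ⟨RFreeAct s, RFreeAct_rel⟩ x
        (Finsupp.single ⟨[], List.nodup_nil⟩ 1)
      map_zero' := by simp
      map_add' := fun x y => by simp }

theorem RRing_coord_monomial {s : ℕ} (l : {l : List (Fin s) // l.Nodup}) :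
    RRing_coord s (RMonomial l.val) = Finsupp.single l 1 := by
  change RingQuot.lift ⟨RFreeAct s, RFreeAct_rel⟩ (RingQuot.mkRingHom (RRel s) _) _ = _
  rw [RingQuot.lift_mkRingHom_apply, RFreeAct_prod, RGenAct_prod]
  have h : (l.val ++ []).Nodup := by simpa using l.2
  rw [dif_pos h]
  simp

/-- The additive group of `R(y_1, …, y_s)` is free abelian with basis the images of the
monomials `y_{j_1} ⋯ y_{j_r}` indexed by duplicate-free lists of indices. -/
theorem RRing_free_basis (s : ℕ) :
    ∃ B : Module.Basis {l : List (Fin s) // l.Nodup} ℤ (RRing s),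
      ∀ l : {l : List (Fin s) // l.Nodup}, B l = RMonomial l.val := by
  have hli : LinearIndependent ℤ
      (fun l : {l : List (Fin s) // l.Nodup} => (RMonomial l.val : RRing s)) := by
    apply LinearIndependent.of_comp (RRing_coord s)
    have : (RRing_coord s) ∘ (fun l : {l : List (Fin s) // l.Nodup} => (RMonomial l.val : RRing s))
        = fun l => Finsupp.single l (1 : ℤ) := by
      funext l
      exact RRing_coord_monomial l
    rw [this]
    exact Finsupp.linearIndependent_single_one ℤ _
  refine ⟨Module.Basis.mk hli ?_, fun l => by rw [Module.Basis.mk_apply]⟩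
  rintro x -
  obtain ⟨a, rfl⟩ := RingQuot.mkRingHom_surjective (RRel s) x
  have ha : a ∈ Submodule.span ℤ (Set.range fun l : List (Fin s) =>
      (l.map (FreeAlgebra.ι ℤ)).prod) := by
    induction a using FreeAlgebra.induction with
    | grade0 r =>
      rw [Algebra.algebraMap_eq_smul_one]
      exact Submodule.smul_mem _ _ (Submodule.subset_span ⟨[], by simp⟩)
    | grade1 i => exact Submodule.subset_span ⟨[i], by simp⟩
    | mul a b ha hb =>
      induction ha using Submodule.span_induction with
      | zero => rw [zero_mul]; exact Submodule.zero_mem _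
      | add x y _ _ hx hy => rw [add_mul]; exact Submodule.add_mem _ hx hy
      | smul r x _ hx => rw [smul_mul_assoc]; exact Submodule.smul_mem _ r hx
      | mem x hx =>
        obtain ⟨l, rfl⟩ := hx
        induction hb using Submodule.span_induction with
        | zero => rw [mul_zero]; exact Submodule.zero_mem _
        | add x y _ _ hx hy => rw [mul_add]; exact Submodule.add_mem _ hx hy
        | smul r x _ hx => rw [mul_smul_comm]; exact Submodule.smul_mem _ r hx
        | mem x hx =>
          obtain ⟨m, rfl⟩ := hx
          exact Submodule.subset_span ⟨l ++ m, by simp⟩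
    | add a b ha hb => exact Submodule.add_mem _ ha hb
  induction ha using Submodule.span_induction with
  | mem a h =>
    obtain ⟨l, rfl⟩ := h
    by_cases hl : l.Nodup
    · exact Submodule.subset_span ⟨⟨l, hl⟩, rfl⟩
    · have : RingQuot.mkRingHom (RRel s) ((l.map (FreeAlgebra.ι ℤ)).prod) = 0 := by
        rw [← map_zero (RingQuot.mkRingHom (RRel s))]
        exact RingQuot.mkRingHom_rel ⟨⟨l, hl, rfl⟩, rfl⟩
      simp only [this]
      exact Submodule.zero_mem _
  | zero => rw [map_zero]; exact Submodule.zero_mem _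
  | add a b _ _ ha hb => rw [map_add]; exact Submodule.add_mem _ ha hb
  | smul r a _ ha => rw [map_zsmul]; exact Submodule.smul_mem _ r ha
end

section
/- In the ring R(y_1, …, y_s), each element 1 + y_i is a unit with inverse 1 − y_i, and the group homomorphism μ : F_s → R(y_1, …, y_s)ˣ from the free group on x_1, …, x_s determined by μ(x_i) = 1 + y_i sends every element of the form [x_i, w⁻¹ x_i w] (1 ≤ i ≤ s, w ∈ F_s) to 1; consequently μ descends to a group homomorphism M(F_s) → R(y_1, …, y_s)ˣ (the Magnus expansion of the free Milnor group). -/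
open scoped commutatorElement

/-- The free Milnor group `M(F_s)`: the Milnor group of the free group on `Fin s`
with respect to its standard generators. -/
abbrev FreeMilnor (s : ℕ) : Type :=
  MilnorGroup (fun i : Fin s => FreeGroup.of i)

theorem RMonomial_dup {s : ℕ} (l : List (Fin s)) (h : ¬ l.Nodup) : RMonomial l = 0 := by
  unfold RMonomial
  rw [← map_zero (RingQuot.mkRingHom (RRel s))]
  exact RingQuot.mkRingHom_rel ⟨⟨l, h, rfl⟩, rfl⟩

theorem RMonomial_append {s : ℕ} (l m : List (Fin s)) :
    RMonomial (l ++ m) = RMonomial l * RMonomial m := by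
  simp [RMonomial]

/-- Additive span of the monomials containing the index `i`. -/
def spanWith {s : ℕ} (i : Fin s) : AddSubgroup (RRing s) :=
  AddSubgroup.closure {x | ∃ l : List (Fin s), i ∈ l ∧ x = RMonomial l}

theorem spanWith_mul {s : ℕ} (i : Fin s) (a : FreeAlgebra ℤ (Fin s)) :
    ∀ n ∈ spanWith i, n * RingQuot.mkRingHom (RRel s) a ∈ spanWith i := by
  induction a using FreeAlgebra.induction with
  | grade0 r =>
    intro n hn
    have : RingQuot.mkRingHom (RRel s) (algebraMap ℤ _ r) = (r : RRing s) := by simp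
    rw [this, ← zsmul_eq_mul']
    exact AddSubgroup.zsmul_mem _ hn r
  | grade1 j =>
    intro n hn
    have hj : RingQuot.mkRingHom (RRel s) (FreeAlgebra.ι ℤ j) = RMonomial [j] := by
      simp [RMonomial]
    rw [hj]
    induction hn using AddSubgroup.closure_induction with
    | mem x hx =>
      obtain ⟨l, hl, rfl⟩ := hx
      exact AddSubgroup.subset_closure ⟨l ++ [j], by simp [hl], (RMonomial_append _ _).symm⟩
    | zero => rw [zero_mul]; exact zero_mem _
    | add x y _ _ hx hy => rw [add_mul]; exact add_mem hx hy
    | neg x _ hx =>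
      have h := neg_mem hx
      exact (neg_mul x (RMonomial [j])).symm ▸ h
  | mul a b ha hb =>
    intro n hn
    rw [map_mul, ← mul_assoc]
    exact hb _ (ha _ hn)
  | add a b ha hb =>
    intro n hn
    rw [map_add, mul_add]
    exact add_mem (ha _ hn) (hb _ hn)

theorem spanWith_mul_self {s : ℕ} (i : Fin s) (n : RRing s) (hn : n ∈ spanWith i) :
    n * RMonomial [i] = 0 := by
  induction hn using AddSubgroup.closure_induction with
  | mem x hx =>
    obtain ⟨l, hl, rfl⟩ := hx
    rw [← RMonomial_append]
    apply RMonomial_dup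
    intro h
    exact (List.nodup_append.1 h).2.2 i hl i (by simp) rfl
  | zero => rw [zero_mul]
  | add x y _ _ hx hy => rw [add_mul, hx, hy, add_zero]
  | neg x _ hx =>
    have h : -(x * RMonomial [i]) = 0 := by rw [hx, neg_zero]
    exact (neg_mul x (RMonomial [i])).trans h

theorem RMonomial_sandwich {s : ℕ} (i : Fin s) (r : RRing s) :
    RMonomial [i] * r * RMonomial [i] = 0 := by
  obtain ⟨a, rfl⟩ := RingQuot.mkRingHom_surjective (RRel s) r
  exact spanWith_mul_self i _ (spanWith_mul i a _
    (AddSubgroup.subset_closure ⟨[i], by simp, rfl⟩))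

theorem RMonomial_sq {s : ℕ} (i : Fin s) : RMonomial [i] * RMonomial [i] = 0 := by
  simpa using RMonomial_sandwich i 1

theorem conj_commute {R : Type*} [Ring R] (y : R) (hy : ∀ r, y * r * y = 0)
    (u w : Rˣ) (hu : (u : R) = 1 + y) : ⁅u, w⁻¹ * u * w⁆ = 1 := by
  rw [commutatorElement_eq_one_iff_mul_comm]
  ext
  have h : ((w⁻¹ * u * w : Rˣ) : R) = 1 + (↑w⁻¹ : R) * y * w := by
    simp [hu, mul_add, add_mul]
  rw [Units.val_mul, Units.val_mul _ u, h, hu]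
  have h1 : y * ((↑w⁻¹ : R) * y * w) = 0 := by
    rw [← mul_assoc, ← mul_assoc, hy, zero_mul]
  have h2 : ((↑w⁻¹ : R) * y * w) * y = 0 := by
    rw [mul_assoc, mul_assoc, ← mul_assoc y, hy, mul_zero]
  rw [add_mul, mul_add, mul_add, add_mul, mul_add, mul_add, h1, h2]
  simp only [mul_one, one_mul, add_zero]
  abel

/-- The Magnus expansion: each `1 + y_i` is a unit of `R(y_1, …, y_s)` with inverse
`1 - y_i`, and the homomorphism `μ` from the free group `F_s` to the units of
`R(y_1, …, y_s)` determined by `μ(x_i) = 1 + y_i` kills all Milnor relators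
`[x_i, w⁻¹ x_i w]`, hence descends to the free Milnor group `M(F_s)`. -/
theorem magnus_expansion (s : ℕ) :
    (∀ i : Fin s, (1 + RMonomial [i]) * (1 - RMonomial [i]) = 1 ∧
      (1 - RMonomial [i]) * (1 + RMonomial [i]) = 1) ∧
    ∃ μ : FreeGroup (Fin s) →* (RRing s)ˣ,
      (∀ i : Fin s, (μ (FreeGroup.of i) : RRing s) = 1 + RMonomial [i]) ∧
      (∀ (i : Fin s) (w : FreeGroup (Fin s)),
        μ ⁅FreeGroup.of i, w⁻¹ * FreeGroup.of i * w⁆ = 1) ∧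
      ∃ μM : FreeMilnor s →* (RRing s)ˣ,
        ∀ w : FreeGroup (Fin s),
          μM (milnorQuot (fun i : Fin s => FreeGroup.of i) w) = μ w := by
  have hinv : ∀ i : Fin s, (1 + RMonomial [i]) * (1 - RMonomial [i]) = 1 ∧
      (1 - RMonomial [i]) * (1 + RMonomial [i]) = 1 := by
    intro i
    constructor
    · simp [mul_sub, add_mul, RMonomial_sq]
    · simp [mul_add, sub_mul, RMonomial_sq]
  refine ⟨hinv, ?_⟩
  let U : Fin s → (RRing s)ˣ := fun i =>
    ⟨1 + RMonomial [i], 1 - RMonomial [i], (hinv i).1, (hinv i).2⟩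
  have hk : ∀ (i : Fin s) (w : FreeGroup (Fin s)),
      FreeGroup.lift U ⁅FreeGroup.of i, w⁻¹ * FreeGroup.of i * w⁆ = 1 := by
    intro i w
    rw [map_commutatorElement, map_mul, map_mul, map_inv]
    apply conj_commute (RMonomial [i]) (RMonomial_sandwich i)
    rw [FreeGroup.lift_apply_of]
  refine ⟨FreeGroup.lift U, fun i => by rw [FreeGroup.lift_apply_of], hk,
    QuotientGroup.lift _ (FreeGroup.lift U) ?_, fun w => rfl⟩
  apply Subgroup.normalClosure_le_normal
  rintro x ⟨i, w, rfl⟩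
  exact hk i w
end

section
/- Let p : M(F_{s+1}) → M(F_s) be the group homomorphism induced by the map of free groups sending x_i ↦ x_i for 1 ≤ i ≤ s and x_{s+1} ↦ 1. Then the kernel of p equals the normal closure in M(F_{s+1}) of the image of x_{s+1}, and this kernel is an abelian subgroup. Moreover p is a split surjection: the homomorphism M(F_s) → M(F_{s+1}) induced by x_i ↦ x_i is a section of p. -/
open scoped commutatorElement

/-- The image of the generator `x_i` in the free Milnor group `M(F_s)`. -/
def fmk {s : ℕ} (i : Fin s) : FreeMilnor s :=
  milnorQuot (fun j : Fin s => FreeGroup.of j) (FreeGroup.of i)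

theorem fmk_comm {s : ℕ} (i : Fin s) (w : FreeMilnor s) :
    fmk i * (w⁻¹ * fmk i * w) = (w⁻¹ * fmk i * w) * fmk i := by
  obtain ⟨v, rfl⟩ := QuotientGroup.mk'_surjective _ w
  have h : milnorQuot (fun j : Fin s => FreeGroup.of j)
      ⁅FreeGroup.of i, v⁻¹ * FreeGroup.of i * v⁆ = 1 :=
    (QuotientGroup.eq_one_iff _).2 (Subgroup.subset_normalClosure ⟨i, v, rfl⟩)
  rw [map_commutatorElement, commutatorElement_eq_one_iff_mul_comm] at h
  simp only [map_mul, map_inv] at h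
  exact h

theorem fm_lift {s : ℕ} {H : Type*} [Group H] (f : Fin s → H)
    (hf : ∀ i w, f i * (w⁻¹ * f i * w) = (w⁻¹ * f i * w) * f i) :
    ∃ φ : FreeMilnor s →* H, ∀ i, φ (fmk i) = f i := by
  refine ⟨QuotientGroup.lift _ (FreeGroup.lift f) ?_, fun i => ?_⟩
  · intro x hx
    have : Subgroup.normalClosure (milnorRelators fun j : Fin s => FreeGroup.of j)
        ≤ (FreeGroup.lift f).ker := by
      refine Subgroup.normalClosure_le_normal ?_
      rintro _ ⟨i, v, rfl⟩
      show FreeGroup.lift f _ = 1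
      rw [map_commutatorElement, commutatorElement_eq_one_iff_mul_comm]
      simpa using hf i (FreeGroup.lift f v)
    exact this hx
  · show FreeGroup.lift f (FreeGroup.of i) = f i
    simp

theorem fm_ext {s : ℕ} {H : Type*} [Group H] (φ ψ : FreeMilnor s →* H)
    (h : ∀ i, φ (fmk i) = ψ (fmk i)) : φ = ψ := by
  apply QuotientGroup.monoidHom_ext
  ext i
  exact h i

/-- The projection `p : M(F_{s+1}) →* M(F_s)` induced by `x_i ↦ x_i` (`i ≤ s`) and
`x_{s+1} ↦ 1` is a split surjection whose kernel is the normal closure of the image of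
`x_{s+1}`, and this kernel is abelian. -/
theorem milnor_projection_kernel (s : ℕ) :
    ∃ (p : FreeMilnor (s + 1) →* FreeMilnor s) (σ : FreeMilnor s →* FreeMilnor (s + 1)),
      (∀ i : Fin s, p (fmk i.castSucc) = fmk i) ∧
      p (fmk (Fin.last s)) = 1 ∧
      (∀ i : Fin s, σ (fmk i) = fmk i.castSucc) ∧
      p.comp σ = MonoidHom.id (FreeMilnor s) ∧
      p.ker = Subgroup.normalClosure ({fmk (Fin.last s)} : Set (FreeMilnor (s + 1))) ∧
      (∀ a ∈ p.ker, ∀ b ∈ p.ker, a * b = b * a) := by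
  obtain ⟨p, hp⟩ := fm_lift (s := s + 1) (H := FreeMilnor s)
    (Fin.lastCases 1 (fun i => fmk i)) (by
      intro i w
      induction i using Fin.lastCases with
      | last => simp
      | cast i => simpa using fmk_comm i w)
  obtain ⟨σ, hσ⟩ := fm_lift (s := s) (H := FreeMilnor (s + 1))
    (fun i => fmk i.castSucc) (fun i w => fmk_comm _ w)
  have hp1 : ∀ i : Fin s, p (fmk i.castSucc) = fmk i := fun i => by simp [hp]
  have hp2 : p (fmk (Fin.last s)) = 1 := by simp [hp]
  have hker : p.ker =
      Subgroup.normalClosure ({fmk (Fin.last s)} : Set (FreeMilnor (s + 1))) := by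
    apply le_antisymm
    · intro a ha
      have key : ((QuotientGroup.mk' (Subgroup.normalClosure
          ({fmk (Fin.last s)} : Set (FreeMilnor (s + 1))))).comp σ).comp p
          = QuotientGroup.mk' _ := by
        apply fm_ext
        intro i
        induction i using Fin.lastCases with
        | last =>
          simp only [MonoidHom.comp_apply, hp2, map_one]
          exact ((QuotientGroup.eq_one_iff _).2
            (Subgroup.subset_normalClosure (Set.mem_singleton _))).symm
        | cast i => simp only [MonoidHom.comp_apply, hp1, hσ]
      have h2 := DFunLike.congr_fun key a
      simp only [MonoidHom.comp_apply, MonoidHom.mem_ker.1 ha, map_one] at h2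
      exact (QuotientGroup.eq_one_iff _).1 h2.symm
    · exact Subgroup.normalClosure_le_normal (by simpa using hp2)
  refine ⟨p, σ, hp1, hp2, hσ, fm_ext _ _ fun i => by simp [hσ, hp1], hker, ?_⟩
  rw [hker]
  intro a ha b hb
  refine Subgroup.closure_induction₂ (p := fun a b _ _ => Commute a b) ?_
    (fun _ _ => Commute.one_left _) (fun _ _ => Commute.one_right _)
    (fun _ _ _ _ _ _ h1 h2 => h1.mul_left h2) (fun _ _ _ _ _ _ h1 h2 => h1.mul_right h2)
    (fun _ _ _ _ h => h.inv_left) (fun _ _ _ _ h => h.inv_right) ha hb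
  intro x y hx hy
  obtain ⟨x', hx', hx⟩ := Group.mem_conjugatesOfSet_iff.1 hx
  obtain ⟨y', hy', hy⟩ := Group.mem_conjugatesOfSet_iff.1 hy
  rw [Set.mem_singleton_iff] at hx' hy'
  subst hx' hy'
  rw [isConj_iff] at hx hy
  obtain ⟨c, rfl⟩ := hx
  obtain ⟨d, rfl⟩ := hy
  have h := fmk_comm (Fin.last s) (d⁻¹ * c)
  have h' : Commute (fmk (Fin.last s))
    ((d⁻¹ * c)⁻¹ * fmk (Fin.last s) * (d⁻¹ * c)) := h
  have h3 := (Commute.conj_iff c).2 h'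
  have h4 : c * ((d⁻¹ * c)⁻¹ * fmk (Fin.last s) * (d⁻¹ * c)) * c⁻¹
      = d * fmk (Fin.last s) * d⁻¹ := by group
  rw [h4] at h3
  exact h3
end

section
/- Milnor's exact sequence: Let p : M(F_{s+1}) → M(F_s) be the homomorphism induced by x_i ↦ x_i (1 ≤ i ≤ s) and x_{s+1} ↦ 1, and let K = ker p (an abelian subgroup of M(F_{s+1})). The unique additive map r from the additive group of R(y_1, …, y_s) to K that sends, for each duplicate-free list (j_1, …, j_r) of indices from {1, …, s}, the basis monomial y_{j_1} ⋯ y_{j_r} to the left-iterated commutator [x_{j_1}, [x_{j_2}, …, [x_{j_r}, x_{s+1}] … ]] (the empty list's monomial 1 being sent to x_{s+1}) is a group isomorphism from (R(y_1, …, y_s), +) onto K. -/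
open scoped commutatorElement

/-- Left-iterated commutator `[f j₁, [f j₂, …, [f jᵣ, base]…]]`; the empty list
gives `base`. -/
def leftIterComm {G : Type*} [Group G] {ι : Type*} (f : ι → G) (base : G) :
    List ι → G
  | [] => base
  | j :: t => ⁅f j, leftIterComm f base t⁆


namespace MilnorProof

/-! ### Commutation in the free Milnor group -/

theorem fmk_comm_conj {n : ℕ} (i : Fin n) (g : FreeMilnor n) :
    Commute (fmk i) (g⁻¹ * fmk i * g) := by
  obtain ⟨h, rfl⟩ := QuotientGroup.mk'_surjective _ g
  have hmem : ⁅FreeGroup.of i, h⁻¹ * FreeGroup.of i * h⁆ ∈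
      Subgroup.normalClosure (milnorRelators (fun j : Fin n => FreeGroup.of j)) :=
    Subgroup.subset_normalClosure ⟨i, h, rfl⟩
  have h1 := (QuotientGroup.eq_one_iff _).2 hmem
  rw [← commutatorElement_eq_one_iff_commute]
  exact h1

/-- Normal closure of the generator `x_i`. -/
abbrev NC {n : ℕ} (i : Fin n) : Subgroup (FreeMilnor n) := Subgroup.normalClosure {fmk i}

theorem NC_comm_gen {n : ℕ} (i : Fin n) {k : FreeMilnor n} (hk : k ∈ NC i) :
    Commute (fmk i) k := by
  have hle : NC i ≤ Subgroup.centralizer {fmk i} := by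
    refine (Subgroup.closure_le _).2 ?_
    intro x hx
    rw [Group.mem_conjugatesOfSet_iff] at hx
    obtain ⟨a, ha, hc⟩ := hx
    rw [Set.mem_singleton_iff] at ha
    subst ha
    obtain ⟨c, rfl⟩ := isConj_iff.1 hc
    rw [SetLike.mem_coe, Subgroup.mem_centralizer_singleton_iff]
    have := fmk_comm_conj i c⁻¹
    rw [inv_inv] at this
    first
      | exact this.eq
      | exact this.eq.symm
  have := hle hk
  rw [Subgroup.mem_centralizer_singleton_iff] at this
  first
    | exact this
    | exact this.symm

theorem NC_comm {n : ℕ} (i : Fin n) {k m : FreeMilnor n} (hk : k ∈ NC i) (hm : m ∈ NC i) :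
    k * m = m * k := by
  have hle : NC i ≤ Subgroup.centralizer {k} := by
    refine (Subgroup.closure_le _).2 ?_
    intro x hx
    rw [Group.mem_conjugatesOfSet_iff] at hx
    obtain ⟨a, ha, hc⟩ := hx
    rw [Set.mem_singleton_iff] at ha
    subst ha
    obtain ⟨c, rfl⟩ := isConj_iff.1 hc
    rw [SetLike.mem_coe, Subgroup.mem_centralizer_singleton_iff]
    have hk' : c⁻¹ * k * c ∈ NC i := by
      have := (Subgroup.normalClosure_normal (s := {fmk i})).conj_mem k hk c⁻¹
      rwa [inv_inv] at this
    have h := (NC_comm_gen i hk').eq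
    have e1 : k * (c * fmk i * c⁻¹) = c * ((c⁻¹ * k * c) * fmk i) * c⁻¹ := by group
    have e2 : (c * fmk i * c⁻¹) * k = c * (fmk i * (c⁻¹ * k * c)) * c⁻¹ := by group
    rw [e1, e2, h]
  have := hle hm
  rw [Subgroup.mem_centralizer_singleton_iff] at this
  first
    | exact this
    | exact this.symm

theorem comm_mem_NC {n : ℕ} (i : Fin n) (k : FreeMilnor n) :
    fmk i * k * (fmk i)⁻¹ * k⁻¹ ∈ NC i := by
  have hx : fmk i ∈ NC i := Subgroup.subset_normalClosure rfl
  have := (Subgroup.normalClosure_normal (s := {fmk i})).conj_mem _ (inv_mem hx) k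
  have h2 := mul_mem hx this
  simpa [mul_assoc] using h2

/-- The kernel, as a normal closure. -/
abbrev K (s : ℕ) : Subgroup (FreeMilnor (s + 1)) := NC (Fin.last s)

noncomputable instance (s : ℕ) : CommGroup (K s) :=
  { (inferInstance : Group (K s)) with
    mul_comm := fun a b => Subtype.ext (NC_comm _ a.2 b.2) }

theorem end_mul {A : Type*} [AddCommMonoid A] (f g : AddMonoid.End A) (x : A) :
    (f * g) x = f (g x) := rfl

/-- Conjugation by a group element on the kernel. -/
noncomputable def cj {s : ℕ} (g : FreeMilnor (s + 1)) : AddMonoid.End (Additive (K s)) :=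
  MonoidHom.toAdditive (MulAut.conjNormal (H := K s) g).toMonoidHom

/-- The operator `x_i - 1`. -/
noncomputable def Yop {s : ℕ} (i : Fin s) : AddMonoid.End (Additive (K s)) :=
  cj (fmk i.castSucc) - 1

/-- Underlying group element. -/
def vl {s : ℕ} (k : Additive (K s)) : FreeMilnor (s + 1) := (k.toMul : FreeMilnor (s + 1))

theorem vl_inj {s : ℕ} {k m : Additive (K s)} (h : vl k = vl m) : k = m :=
  Subtype.ext h

theorem vl_add {s : ℕ} (k m : Additive (K s)) : vl (k + m) = vl k * vl m := rfl

theorem vl_zero {s : ℕ} : vl (0 : Additive (K s)) = 1 := rfl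

theorem vl_neg {s : ℕ} (k : Additive (K s)) : vl (-k) = (vl k)⁻¹ := rfl

theorem vl_cj {s : ℕ} (g : FreeMilnor (s + 1)) (k : Additive (K s)) :
    vl (cj g k) = g * vl k * g⁻¹ := rfl

theorem vl_Yop {s : ℕ} (i : Fin s) (k : Additive (K s)) :
    vl (Yop i k) = ⁅fmk i.castSucc, vl k⁆ := by
  have : Yop i k = cj (fmk i.castSucc) k + -k := by
    rw [← sub_eq_add_neg]; rfl
  rw [this, vl_add, vl_neg, vl_cj, commutatorElement_def]

theorem Yop_mem {s : ℕ} (i : Fin s) (k : Additive (K s)) :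
    vl (Yop i k) ∈ NC i.castSucc := by
  rw [vl_Yop]; exact comm_mem_NC _ _

theorem Yop_pres {s : ℕ} (i j : Fin s) (k : Additive (K s)) (hk : vl k ∈ NC i.castSucc) :
    vl (Yop j k) ∈ NC i.castSucc := by
  rw [vl_Yop, commutatorElement_def]
  exact mul_mem ((Subgroup.normalClosure_normal).conj_mem _ hk _) (inv_mem hk)

theorem Yop_kill {s : ℕ} (i : Fin s) (k : Additive (K s)) (hk : vl k ∈ NC i.castSucc) :
    Yop i k = 0 := by
  apply vl_inj
  rw [vl_Yop, vl_zero, commutatorElement_eq_one_iff_commute]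
  exact NC_comm_gen _ hk

theorem prod_pres {s : ℕ} (i : Fin s) (l : List (Fin s)) (k : Additive (K s))
    (hk : vl k ∈ NC i.castSucc) : vl ((l.map Yop).prod k) ∈ NC i.castSucc := by
  induction l with
  | nil => simpa using hk
  | cons j t ih =>
    rw [List.map_cons, List.prod_cons, end_mul]
    exact Yop_pres _ _ _ ih

theorem Yop_dup {s : ℕ} (l : List (Fin s)) (hl : ¬ l.Nodup) :
    (l.map (Yop (s := s))).prod = 0 := by
  induction l with
  | nil => simp at hl
  | cons j t ih =>
    rw [List.map_cons, List.prod_cons]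
    by_cases ht : t.Nodup
    · have hj : j ∈ t := by
        by_contra hj
        exact hl (List.nodup_cons.2 ⟨hj, ht⟩)
      obtain ⟨a, b, rfl⟩ := List.append_of_mem hj
      rw [List.map_append, List.prod_append, List.map_cons, List.prod_cons]
      ext k
      rw [end_mul, end_mul, end_mul]
      exact congrArg _ (Yop_kill j _ (prod_pres j a _ (Yop_mem j _)))
    · rw [ih ht, mul_zero]

/-- The ring action of Milnor's ring on the kernel. -/
noncomputable def act (s : ℕ) : RRing s →+* AddMonoid.End (Additive (K s)) :=
  RingQuot.lift ⟨(FreeAlgebra.lift ℤ (Yop (s := s)) :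
      FreeAlgebra ℤ (Fin s) →ₐ[ℤ] AddMonoid.End (Additive (K s))).toRingHom, by
    rintro x y ⟨⟨l, hl, rfl⟩, rfl⟩
    have h := Yop_dup l hl
    simp only [AlgHom.toRingHom_eq_coe, RingHom.coe_coe, map_zero, map_list_prod, List.map_map]
    rw [← h]
    congr 1
    apply List.map_congr_left
    intro a _
    simp⟩

/-- generator of the ring -/
def yy {s : ℕ} (i : Fin s) : RRing s := RingQuot.mkRingHom (RRel s) (FreeAlgebra.ι ℤ i)

theorem act_yy {s : ℕ} (i : Fin s) : act s (yy i) = Yop i := by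
  unfold act yy
  rw [RingQuot.lift_mkRingHom_apply]
  simp

theorem RMonomial_cons {s : ℕ} (i : Fin s) (l : List (Fin s)) :
    RMonomial (i :: l) = yy i * RMonomial l := by
  simp [RMonomial, yy]

theorem RMonomial_nil {s : ℕ} : RMonomial ([] : List (Fin s)) = 1 := by
  simp [RMonomial]

theorem RMonomial_dup {s : ℕ} (l : List (Fin s)) (hl : ¬ l.Nodup) : RMonomial l = 0 := by
  unfold RMonomial
  rw [← map_zero (RingQuot.mkRingHom (RRel s))]
  exact RingQuot.mkRingHom_rel ⟨⟨l, hl, rfl⟩, rfl⟩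

/-- Induction principle for Milnor's ring. -/
theorem RRing_ind {s : ℕ} (P : RRing s → Prop) (h1 : P 1) (hy : ∀ i, P (yy i))
    (hadd : ∀ a b, P a → P b → P (a + b)) (hneg : ∀ a, P a → P (-a))
    (hmul : ∀ a b, P a → P b → P (a * b)) (a : RRing s) : P a := by
  obtain ⟨w, rfl⟩ := RingQuot.mkRingHom_surjective _ a
  have h0 : P 0 := by
    have := hadd _ _ h1 (hneg _ h1)
    rwa [add_neg_cancel] at this
  induction w using FreeAlgebra.induction with
  | grade0 r =>
    have : RingQuot.mkRingHom (RRel s) (algebraMap ℤ _ r) = (r : RRing s) := by simp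
    rw [this]
    induction r using Int.induction_on with
    | zero => simpa using h0
    | succ n ih =>
      push_cast at *
      exact hadd _ _ (ih (by simp)) h1
    | pred n ih =>
      push_cast at *
      rw [sub_eq_add_neg]
      exact hadd _ _ (ih (by simp)) (hneg _ h1)
  | grade1 i => exact hy i
  | mul a b ha hb => rw [map_mul]; exact hmul _ _ ha hb
  | add a b ha hb => rw [map_add]; exact hadd _ _ ha hb

theorem r_mul_neg {s : ℕ} (a b : RRing s) : a * -b = -(a * b) := by exact mul_neg a b

theorem r_neg_mul {s : ℕ} (a b : RRing s) : -a * b = -(a * b) := by exact neg_mul a b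

theorem r_neg_zero {s : ℕ} : -(0 : RRing s) = 0 := by exact neg_zero

theorem r_add_neg {s : ℕ} (a : RRing s) : a + -a = 0 := by exact add_neg_cancel a

theorem mem_span {s : ℕ} (a : RRing s) :
    ∀ z ∈ AddSubgroup.closure (Set.range (RMonomial (s := s))),
      a * z ∈ AddSubgroup.closure (Set.range (RMonomial (s := s))) := by
  refine RRing_ind (P := fun a => ∀ z ∈ AddSubgroup.closure (Set.range (RMonomial (s := s))),
      a * z ∈ AddSubgroup.closure (Set.range (RMonomial (s := s)))) ?_ ?_ ?_ ?_ ?_ a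
  · intro z hz; rwa [one_mul]
  · intro i z hz
    induction hz using AddSubgroup.closure_induction with
    | mem x hx =>
      obtain ⟨l, rfl⟩ := hx
      rw [← RMonomial_cons]
      exact AddSubgroup.subset_closure ⟨_, rfl⟩
    | zero => rw [mul_zero]; exact zero_mem _
    | add x y _ _ hx hy => rw [mul_add]; exact add_mem hx hy
    | neg x _ hx => rw [r_mul_neg]; exact neg_mem hx
  · intro a b ha hb z hz; rw [add_mul]; exact add_mem (ha z hz) (hb z hz)
  · intro a ha z hz; rw [r_neg_mul]; exact neg_mem (ha z hz)
  · intro a b ha hb z hz; rw [mul_assoc]; exact ha _ (hb z hz)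

theorem RMonomial_append {s : ℕ} (l m : List (Fin s)) :
    RMonomial (l ++ m) = RMonomial l * RMonomial m := by
  simp [RMonomial]

theorem yzy {s : ℕ} (i : Fin s) (z : RRing s) : yy i * z * yy i = 0 := by
  have hz : z ∈ AddSubgroup.closure (Set.range (RMonomial (s := s))) := by
    have := mem_span z 1 (AddSubgroup.subset_closure ⟨[], RMonomial_nil⟩)
    rwa [mul_one] at this
  induction hz using AddSubgroup.closure_induction with
  | mem x hx =>
    obtain ⟨l, rfl⟩ := hx
    have e : yy i = RMonomial [i] := by rw [RMonomial_cons, RMonomial_nil, mul_one]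
    rw [e, ← RMonomial_append, ← RMonomial_append]
    apply RMonomial_dup
    simp
  | zero => simp
  | add x y _ _ hx hy => rw [mul_add, add_mul, hx, hy, add_zero]
  | neg x _ hx => rw [r_mul_neg, r_neg_mul, hx, r_neg_zero]

theorem yy_sq {s : ℕ} (i : Fin s) : yy i * yy i = 0 := by
  have := yzy i 1
  rwa [mul_one] at this

/-! ### The affine group of a ring -/

/-- Affine maps `v ↦ u v + a` of a ring. -/
@[ext] structure Aff (R : Type*) [Ring R] where
  a : R
  u : Rˣ

namespace Aff
variable {R : Type*} [Ring R]

instance : Mul (Aff R) := ⟨fun f g => ⟨f.a + f.u * g.a, f.u * g.u⟩⟩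
instance : One (Aff R) := ⟨⟨0, 1⟩⟩
instance : Inv (Aff R) := ⟨fun f => ⟨-((f.u⁻¹ : Rˣ) * f.a), f.u⁻¹⟩⟩

theorem mul_a (f g : Aff R) : (f * g).a = f.a + f.u * g.a := rfl
theorem mul_u (f g : Aff R) : (f * g).u = f.u * g.u := rfl
theorem one_a : (1 : Aff R).a = 0 := rfl
theorem one_u : (1 : Aff R).u = 1 := rfl
theorem inv_a (f : Aff R) : (f⁻¹).a = -((f.u⁻¹ : Rˣ) * f.a) := rfl
theorem inv_u (f : Aff R) : (f⁻¹).u = f.u⁻¹ := rfl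

instance : Group (Aff R) := Group.ofLeftAxioms
  (by intro f g h; ext <;> simp [mul_a, mul_u, mul_add, mul_assoc, add_assoc])
  (by intro f; ext <;> simp [mul_a, mul_u, one_a, one_u])
  (by intro f; ext <;> simp [mul_a, mul_u, one_a, one_u, inv_a, inv_u])

/-- translation -/
def tr (b : R) : Aff R := ⟨b, 1⟩

theorem tr_mul (b c : R) : tr (b + c) = tr b * tr c := by
  ext <;> simp [tr, mul_a, mul_u]

theorem tr_inj {b c : R} (h : tr b = tr c) : b = c := congrArg Aff.a h

end Aff

/-- The unit `1 + y_i`. -/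
noncomputable def un {s : ℕ} (i : Fin s) : (RRing s)ˣ where
  val := 1 + yy i
  inv := 1 - yy i
  val_inv := by
    have := yy_sq i
    rw [mul_sub, add_mul, add_mul, this]; simp
  inv_val := by
    have := yy_sq i
    rw [mul_add, sub_mul, sub_mul, this]; simp

/-- images of the generators -/
noncomputable def gen {s : ℕ} : Fin (s + 1) → Aff (RRing s) :=
  Fin.lastCases (Aff.tr 1) (fun i => ⟨0, un i⟩)

theorem gen_rel {s : ℕ} (i : Fin (s + 1)) (H : Aff (RRing s)) :
    Commute (gen i) (H⁻¹ * gen i * H) := by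
  obtain ⟨a, u⟩ := H
  refine Fin.lastCases ?_ (fun i => ?_) i
  · show _ * _ = _ * _
    simp only [gen, Fin.lastCases_last]
    ext <;> simp [Aff.tr, Aff.mul_a, Aff.mul_u, Aff.inv_a, Aff.inv_u]
    abel
  · show _ * _ = _ * _
    simp only [gen, Fin.lastCases_castSucc]
    have h1 : ∀ z w : RRing s, yy i * (z * (yy i * w)) = 0 := by
      intro z w
      rw [← mul_assoc, ← mul_assoc, yzy, zero_mul]
    have h2 : ∀ z : RRing s, yy i * (z * yy i) = 0 := by
      intro z
      rw [← mul_assoc, yzy]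
    ext
    · simp [Aff.mul_a, Aff.mul_u, Aff.inv_a, Aff.inv_u, un, mul_add, add_mul, mul_assoc, h1, h2]
    · simp [Aff.mul_a, Aff.mul_u, Aff.inv_a, Aff.inv_u, un, mul_add, add_mul, mul_assoc, h1, h2]
      try abel

/-- The universal property of the free Milnor group. -/
theorem exists_lift {n : ℕ} {H : Type*} [Group H] (f : Fin n → H)
    (hf : ∀ i, ∀ h ∈ Subgroup.closure (Set.range f), Commute (f i) (h⁻¹ * f i * h)) :
    ∃ F : FreeMilnor n →* H, ∀ i, F (fmk i) = f i := by
  refine ⟨QuotientGroup.lift _ (FreeGroup.lift f) ?_, ?_⟩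
  · intro x hx
    have hle : Subgroup.normalClosure (milnorRelators (fun j : Fin n => FreeGroup.of j)) ≤
        (FreeGroup.lift f).ker := by
      refine Subgroup.normalClosure_le_normal ?_
      rintro _ ⟨i, h, rfl⟩
      rw [SetLike.mem_coe, MonoidHom.mem_ker, map_commutatorElement,
        commutatorElement_eq_one_iff_commute]
      have := hf i (FreeGroup.lift f h) (by
        rw [← FreeGroup.range_lift_eq_closure]; exact ⟨h, rfl⟩)
      simpa using this
    exact hle hx
  · intro i
    exact FreeGroup.lift_apply_of

theorem hom_ext {n : ℕ} {H : Type*} [Group H] {F G : FreeMilnor n →* H}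
    (h : ∀ i, F (fmk i) = G (fmk i)) : F = G := by
  apply QuotientGroup.monoidHom_ext
  apply FreeGroup.ext_hom
  exact h

/-- last generator as an element of the kernel -/
def tt (s : ℕ) : Additive (K s) :=
  Additive.ofMul ⟨fmk (Fin.last s), Subgroup.subset_normalClosure rfl⟩

/-- Milnor's map. -/
noncomputable def rr (s : ℕ) (Y : RRing s) : FreeMilnor (s + 1) := vl (act s Y (tt s))

theorem rr_add {s : ℕ} (Y Z : RRing s) : rr s (Y + Z) = rr s Y * rr s Z := by
  unfold rr
  rw [map_add]; rfl

theorem rr_mono {s : ℕ} (l : List (Fin s)) : rr s (RMonomial l) =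
    leftIterComm (fun i : Fin s => fmk i.castSucc) (fmk (Fin.last s)) l := by
  induction l with
  | nil => unfold rr; rw [RMonomial_nil, map_one]; rfl
  | cons i l ih =>
    unfold rr at *
    rw [RMonomial_cons, map_mul, act_yy, end_mul, vl_Yop, ih]; rfl

theorem rr_inj (s : ℕ) : Function.Injective (rr s) := by
  obtain ⟨F, hF⟩ := exists_lift (gen (s := s)) (fun i h _ => gen_rel i h)
  have key : ∀ Y : RRing s, ∀ k b, F (vl k) = Aff.tr b → F (vl (act s Y k)) = Aff.tr (Y * b) := by
    intro Y
    refine RRing_ind (P := fun Y => ∀ k b, F (vl k) = Aff.tr b →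
      F (vl (act s Y k)) = Aff.tr (Y * b)) ?_ ?_ ?_ ?_ ?_ Y
    · intro k b h
      rw [map_one, one_mul]; exact h
    · intro i k b h
      rw [act_yy, vl_Yop, map_commutatorElement, h, hF]
      have : gen i.castSucc = (⟨0, un i⟩ : Aff (RRing s)) := by simp [gen]
      rw [this, commutatorElement_def, mul_inv_eq_iff_eq_mul, mul_inv_eq_iff_eq_mul]
      ext
      · simp [Aff.tr, Aff.mul_a, Aff.mul_u, un, add_mul, add_comm]
      · simp [Aff.tr, Aff.mul_a, Aff.mul_u]
    · intro A B hA hB k b h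
      have e : vl (act s (A + B) k) = vl (act s A k) * vl (act s B k) := by rw [map_add]; rfl
      rw [e, map_mul, hA k b h, hB k b h, add_mul, Aff.tr_mul]
    · intro A hA k b h
      have e : vl (act s (-A) k) = (vl (act s A k))⁻¹ := by rw [map_neg]; rfl
      rw [e, map_inv, hA k b h, inv_eq_iff_mul_eq_one, ← Aff.tr_mul, r_neg_mul, r_add_neg]
      rfl
    · intro A B hA hB k b h
      rw [map_mul, end_mul, mul_assoc]
      exact hA _ _ (hB k b h)
  have k2 : ∀ Y, F (rr s Y) = Aff.tr Y := by
    intro Y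
    have := key Y (tt s) 1 (by
      have := hF (Fin.last s)
      simp only [gen, Fin.lastCases_last] at this
      exact this)
    rwa [mul_one] at this
  intro Y Z h
  apply Aff.tr_inj
  rw [← k2, ← k2, h]

theorem rr_mem {s : ℕ} (Y : RRing s) : rr s Y ∈ K s := (act s Y (tt s)).toMul.2

/-- The image of `rr` -/
noncomputable def img (s : ℕ) : Subgroup (FreeMilnor (s + 1)) where
  carrier := Set.range (rr s)
  one_mem' := ⟨0, by unfold rr; rw [map_zero]; rfl⟩
  mul_mem' := by
    rintro _ _ ⟨Y, rfl⟩ ⟨Z, rfl⟩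
    exact ⟨Y + Z, rr_add Y Z⟩
  inv_mem' := by
    rintro _ ⟨Y, rfl⟩
    exact ⟨-Y, by unfold rr; rw [map_neg]; rfl⟩

theorem closure_fmk (n : ℕ) : Subgroup.closure (Set.range (fmk (s := n))) = ⊤ := by
  have h : Subgroup.map (milnorQuot (fun j : Fin n => FreeGroup.of j))
      (Subgroup.closure (Set.range FreeGroup.of)) =
      Subgroup.closure (Set.range (fmk (s := n))) := by
    rw [MonoidHom.map_closure, ← Set.range_comp]; rfl
  rw [← h, FreeGroup.closure_range_of, ← MonoidHom.range_eq_map]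
  exact MonoidHom.range_eq_top.2 (QuotientGroup.mk'_surjective _)

theorem conj_gen {s : ℕ} (i : Fin s) (Y : RRing s) :
    fmk i.castSucc * rr s Y * (fmk i.castSucc)⁻¹ = rr s ((1 + yy i) * Y) := by
  rw [add_mul, one_mul, rr_add]
  have : rr s (yy i * Y) = ⁅fmk i.castSucc, rr s Y⁆ := by
    unfold rr
    rw [map_mul, act_yy, end_mul, vl_Yop]
  rw [this]
  have hc : rr s Y * ⁅fmk i.castSucc, rr s Y⁆ = ⁅fmk i.castSucc, rr s Y⁆ * rr s Y := by
    refine NC_comm (Fin.last s) (rr_mem Y) ?_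
    rw [← this]; exact rr_mem _
  rw [hc, commutatorElement_def, inv_mul_cancel_right]

theorem img_conj {s : ℕ} (g : FreeMilnor (s + 1)) :
    ∀ x, x ∈ img s → g * x * g⁻¹ ∈ img s := by
  have hg : g ∈ Subgroup.closure (Set.range (fmk (s := s + 1))) := by
    rw [closure_fmk]; trivial
  have key : ∀ i : Fin (s + 1), (∀ x ∈ img s, fmk i * x * (fmk i)⁻¹ ∈ img s) ∧
      (∀ x ∈ img s, (fmk i)⁻¹ * x * (fmk i) ∈ img s) := by
    intro i
    refine Fin.lastCases ?_ (fun i => ?_) i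
    · constructor
      · rintro _ ⟨Y, rfl⟩
        rw [(NC_comm_gen (Fin.last s) (rr_mem Y)).eq, mul_inv_cancel_right]
        exact ⟨Y, rfl⟩
      · rintro _ ⟨Y, rfl⟩
        rw [mul_assoc, ← (NC_comm_gen (Fin.last s) (rr_mem Y)).eq, inv_mul_cancel_left]
        exact ⟨Y, rfl⟩
    · constructor
      · rintro _ ⟨Y, rfl⟩
        exact ⟨_, (conj_gen i Y).symm⟩
      · rintro _ ⟨Y, rfl⟩
        refine ⟨(1 - yy i) * Y, ?_⟩
        have := conj_gen i ((1 - yy i) * Y)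
        have e : (1 + yy i) * ((1 - yy i) * Y) = Y := by
          rw [← mul_assoc]
          have : (1 + yy i) * (1 - yy i) = 1 := (un i).val_inv
          rw [this, one_mul]
        rw [e] at this
        rw [← this]; group
  induction hg using Subgroup.closure_induction'' with
  | mem x hx => obtain ⟨i, rfl⟩ := hx; exact (key i).1
  | inv_mem x hx =>
    obtain ⟨i, rfl⟩ := hx
    intro x hx
    rw [inv_inv]; exact (key i).2 x hx
  | one => intro x hx; simpa using hx
  | mul a b _ _ ha hb =>
    intro x hx
    have := ha _ (hb x hx)
    have e : a * b * x * (a * b)⁻¹ = a * (b * x * b⁻¹) * a⁻¹ := by group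
    rwa [e]

theorem K_le_img (s : ℕ) : K s ≤ img s := by
  have : (img s).Normal := ⟨fun x hx g => img_conj g x hx⟩
  refine Subgroup.normalClosure_le_normal ?_
  rintro _ rfl
  exact ⟨1, by unfold rr; rw [map_one]; rfl⟩

end MilnorProof

open MilnorProof in
/-- Milnor's exact sequence: the additive map `r` from `(R(y_1, …, y_s), +)` determined
on the basis of duplicate-free monomials by sending `y_{j_1} ⋯ y_{j_r}` to the
left-iterated commutator `[x_{j_1}, [x_{j_2}, …, [x_{j_r}, x_{s+1}]…]]` (and `1` to
`x_{s+1}`) is a group isomorphism onto the kernel of `p : M(F_{s+1}) →* M(F_s)`. -/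
theorem milnor_exact_sequence (s : ℕ) :
    ∃ p : FreeMilnor (s + 1) →* FreeMilnor s,
      (∀ i : Fin s, p (fmk i.castSucc) = fmk i) ∧
      p (fmk (Fin.last s)) = 1 ∧
      ∃ r : RRing s → FreeMilnor (s + 1),
        (∀ Y Z : RRing s, r (Y + Z) = r Y * r Z) ∧
        (∀ l : List (Fin s), l.Nodup →
          r (RMonomial l) =
            leftIterComm (fun i : Fin s => fmk i.castSucc) (fmk (Fin.last s)) l) ∧
        Function.Injective r ∧
        (∀ x : FreeMilnor (s + 1), x ∈ p.ker ↔ ∃ Y : RRing s, r Y = x) := by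
  obtain ⟨p, hp⟩ := exists_lift (n := s + 1)
    (Fin.lastCases (motive := fun _ => FreeMilnor s) 1 (fun i => fmk i)) (by
      intro i h _
      refine Fin.lastCases ?_ (fun i => ?_) i
      · simp only [Fin.lastCases_last]; exact Commute.one_left _
      · simp only [Fin.lastCases_castSucc]; exact fmk_comm_conj i h)
  obtain ⟨σ, hσ⟩ := exists_lift (n := s) (fun i => fmk (s := s + 1) i.castSucc)
    (fun i h _ => fmk_comm_conj _ h)
  have hp1 : ∀ i : Fin s, p (fmk i.castSucc) = fmk i := by
    intro i; rw [hp]; simp only [Fin.lastCases_castSucc]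
  have hp2 : p (fmk (Fin.last s)) = 1 := by
    rw [hp]; simp only [Fin.lastCases_last]
  refine ⟨p, hp1, hp2, rr s, rr_add, fun l _ => rr_mono l, rr_inj s, fun x => ⟨fun hx => ?_, ?_⟩⟩
  · apply K_le_img
    have e : (QuotientGroup.mk' (K s)) = ((QuotientGroup.mk' (K s)).comp σ).comp p := by
      apply hom_ext
      intro i
      refine Fin.lastCases ?_ (fun i => ?_) i
      · simp only [MonoidHom.comp_apply]
        rw [hp2, map_one, map_one]
        exact (QuotientGroup.eq_one_iff _).2 (Subgroup.subset_normalClosure rfl)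
      · simp only [MonoidHom.comp_apply]
        rw [hp1, hσ]
    have e2 := DFunLike.congr_fun e x
    simp only [MonoidHom.comp_apply] at e2
    rw [MonoidHom.mem_ker.1 hx, map_one, map_one] at e2
    exact (QuotientGroup.eq_one_iff _).1 e2
  · rintro ⟨Y, rfl⟩
    have hle : K s ≤ p.ker := by
      refine Subgroup.normalClosure_le_normal ?_
      rintro _ rfl
      exact hp2
    exact hle (rr_mem Y)
end

section
/- In the free Milnor group M(F_s): for any list (j_1, …, j_r) of indices from {1, …, s} with r ≥ 2 in which some index occurs at least twice, the left-iterated commutator [x_{j_1}, [x_{j_2}, …, [x_{j_{r−1}}, x_{j_r}] … ]] is trivial. -/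
open scoped commutatorElement

/-- The left-iterated commutator `[f j₁, [f j₂, …, [f j_{r-1}, f j_r]…]]` of a list of
indices; a singleton list gives the generator itself, the empty list gives `1`. -/
def listIterComm {G : Type*} [Group G] {ι : Type*} (f : ι → G) : List ι → G
  | [] => 1
  | [j] => f j
  | j :: t :: ts => ⁅f j, listIterComm f (t :: ts)⁆

theorem fmk_commute_conj {s : ℕ} (i : Fin s) (c : FreeMilnor s) :
    Commute (fmk i) (c * fmk i * c⁻¹) := by
  obtain ⟨w, rfl⟩ := QuotientGroup.mk'_surjective _ c
  rw [← commutatorElement_eq_one_iff_commute]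
  have h : ⁅FreeGroup.of i, (w⁻¹)⁻¹ * FreeGroup.of i * w⁻¹⁆ ∈
      Subgroup.normalClosure (milnorRelators (fun j : Fin s => FreeGroup.of j)) :=
    Subgroup.subset_normalClosure ⟨i, w⁻¹, rfl⟩
  have h2 := (QuotientGroup.eq_one_iff _).2 h
  rw [inv_inv] at h2
  exact h2

theorem fmk_commute_normalClosure {s : ℕ} (i : Fin s) (c : FreeMilnor s)
    (hc : c ∈ Subgroup.normalClosure {fmk i}) : Commute (fmk i) c := by
  have hle : Subgroup.normalClosure {fmk i} ≤ Subgroup.centralizer {fmk i} := by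
    refine (Subgroup.closure_le _).2 ?_
    intro x hx
    obtain ⟨a, ha, hax⟩ := Group.mem_conjugatesOfSet_iff.1 hx
    rw [Set.mem_singleton_iff] at ha
    subst ha
    obtain ⟨d, rfl⟩ := isConj_iff.1 hax
    rw [SetLike.mem_coe, Subgroup.mem_centralizer_singleton_iff]
    exact (fmk_commute_conj i d).eq.symm
  exact (Subgroup.mem_centralizer_singleton_iff.1 (hle hc)).symm

theorem listIterComm_mem {G ι : Type*} [Group G] (f : ι → G) (N : Subgroup G) [hN : N.Normal]
    (i : ι) (hi : f i ∈ N) : ∀ l : List ι, i ∈ l → listIterComm f l ∈ N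
  | [], h => by simp at h
  | [j], h => by
    rw [List.mem_singleton] at h
    subst h
    exact hi
  | j :: t :: ts, h => by
    rw [listIterComm]
    rcases List.mem_cons.1 h with h | h
    · subst h
      exact Subgroup.commutator_le_left N ⊤
        (Subgroup.commutator_mem_commutator hi (Subgroup.mem_top _))
    · exact Subgroup.commutator_le_right ⊤ N
        (Subgroup.commutator_mem_commutator (Subgroup.mem_top _)
          (listIterComm_mem f N i hi (t :: ts) h))

theorem iterComm_dup {s : ℕ} : ∀ l : List (Fin s), ¬ l.Nodup →
    listIterComm (fun i : Fin s => fmk i) l = 1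
  | [], h => by simp at h
  | [j], h => by simp at h
  | j :: t :: ts, h => by
    rw [listIterComm]
    by_cases hj : j ∈ t :: ts
    · rw [commutatorElement_eq_one_iff_commute]
      exact fmk_commute_normalClosure j _ (listIterComm_mem _ _ j
        (Subgroup.subset_normalClosure (Set.mem_singleton _)) _ hj)
    · rw [iterComm_dup (t :: ts) (fun h' => h (List.nodup_cons.2 ⟨hj, h'⟩)),
        commutatorElement_one_right]

/-- In the free Milnor group `M(F_s)`, any left-iterated commutator of length at least two
of the generators in which some index repeats is trivial. -/
theorem iterComm_repeat_trivial (s : ℕ) (l : List (Fin s))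
    (hlen : 2 ≤ l.length) (hdup : ¬ l.Nodup) :
    listIterComm (fun i : Fin s => fmk i) l = 1 := by
  exact iterComm_dup l hdup
end

section
/- In the free Milnor group M(F_s): for any nonempty list (j_1, …, j_r) of pairwise distinct indices from {1, …, s}, the left-iterated commutator [x_{j_1}, [x_{j_2}, …, [x_{j_{r−1}}, x_{j_r}] … ]] (which for r = 1 is just x_{j_1}) is a nontrivial element of M(F_s). -/
open scoped commutatorElement

namespace MilnorAux

/-- Matrix units acting on integer sequences. -/
def E (a b : ℕ) : Module.End ℤ (ℕ → ℤ) where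
  toFun v := Pi.single a (v b)
  map_add' u v := by simp [Pi.single_add]
  map_smul' c v := by
    ext i
    by_cases h : i = a
    · subst h; simp
    · simp [h]

theorem E_apply (a b : ℕ) (v : ℕ → ℤ) : E a b v = Pi.single a (v b) := rfl

theorem E_mul_ne (a b c d : ℕ) (h : b ≠ c) : E a b * E c d = 0 := by
  refine LinearMap.ext fun v => ?_
  simp [Module.End.mul_apply, E_apply, h]

theorem E_mul_eq (a b d : ℕ) : E a b * E b d = E a d := by
  refine LinearMap.ext fun v => ?_
  simp [Module.End.mul_apply, E_apply]

/-- Elementary unipotents. -/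
def T (a b : ℕ) (h : a ≠ b) : (Module.End ℤ (ℕ → ℤ))ˣ where
  val := 1 + E a b
  inv := 1 - E a b
  val_inv := by
    have := E_mul_ne a b a b h.symm
    simp [mul_sub, add_mul, this]
  inv_val := by
    have := E_mul_ne a b a b h.symm
    simp [mul_add, sub_mul, this]

/-- Upper triangular endomorphisms. -/
def Tri (A : Module.End ℤ (ℕ → ℤ)) : Prop :=
  ∀ (n : ℕ) (v : ℕ → ℤ), (∀ i, n ≤ i → v i = 0) → ∀ i, n ≤ i → A v i = 0

theorem Tri.mul {A B : Module.End ℤ (ℕ → ℤ)} (hA : Tri A) (hB : Tri B) : Tri (A * B) :=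
  fun n v hv => hA n _ (hB n v hv)

theorem tri_one : Tri 1 := fun _ _ hv => hv

theorem E_tri (a i n : ℕ) (v : ℕ → ℤ) (hv : ∀ i, n ≤ i → v i = 0) (hi : n ≤ i) :
    E a (a + 1) v i = 0 := by
  rw [E_apply]
  by_cases h : i = a
  · subst h
    simp [hv (i + 1) (by omega)]
  · simp [h]

theorem sandwich (a : ℕ) (A : Module.End ℤ (ℕ → ℤ)) (hA : Tri A) :
    E a (a + 1) * A * E a (a + 1) = 0 := by
  refine LinearMap.ext fun v => ?_
  have : A (E a (a + 1) v) (a + 1) = 0 := by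
    apply hA (a + 1) _ _ _ le_rfl
    intro i hi
    rw [E_apply]
    have : i ≠ a := by omega
    simp [this]
  rw [Module.End.mul_apply, Module.End.mul_apply, E_apply a (a + 1) (A _), this]
  simp

/-- The homomorphism out of the free group. -/
def phi {s : ℕ} (p : Fin s → ℕ) : FreeGroup (Fin s) →* (Module.End ℤ (ℕ → ℤ))ˣ :=
  FreeGroup.lift fun i => T (p i) (p i + 1) (by omega)

theorem phi_tri {s : ℕ} (p : Fin s → ℕ) (w : FreeGroup (Fin s)) : Tri (phi p w).val := by
  induction w using FreeGroup.induction_on with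
  | C1 => simpa using tri_one
  | of i =>
    intro n v hv j hj
    simp [phi, T, E_tri _ j n v hv hj, hv j hj]
  | inv_of i _ =>
    intro n v hv j hj
    simp only [phi, map_inv, FreeGroup.lift_apply_of]
    change ((1 - E _ _ : Module.End ℤ (ℕ → ℤ)) v) j = 0
    simp [E_tri _ j n v hv hj, hv j hj]
  | mul x y hx hy =>
    rw [map_mul]
    exact hx.mul hy

theorem phi_rel {s : ℕ} (p : Fin s → ℕ) (i : Fin s) (w : FreeGroup (Fin s)) :
    phi p ⁅FreeGroup.of i, w⁻¹ * FreeGroup.of i * w⁆ = 1 := by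
  rw [map_commutatorElement, commutatorElement_eq_one_iff_mul_comm]
  apply Units.ext
  have h1 := sandwich (p i) _ (phi_tri p w)
  have h2 := sandwich (p i) _ (phi_tri p w⁻¹)
  have h3 : (phi p w⁻¹).val * (phi p w).val = 1 := by
    rw [← Units.val_mul, ← map_mul]; simp
  have h4 : (phi p (FreeGroup.of i)).val = 1 + E (p i) (p i + 1) := by
    simp [phi, T]
  simp only [map_mul, Units.val_mul, h4]
  generalize E (p i) (p i + 1) = e at *
  generalize (phi p w).val = h at *
  generalize (phi p w⁻¹).val = k at *
  have h5 : k * (1 + e) * h = 1 + k * e * h := by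
    rw [mul_add, add_mul, mul_one, h3]
  rw [h5]
  have h6 : e * (k * e * h) = 0 := by
    rw [← mul_assoc, ← mul_assoc, h2, zero_mul]
  have h7 : (k * e * h) * e = 0 := by
    rw [mul_assoc, mul_assoc, ← mul_assoc e, h1, mul_zero]
  rw [mul_add, add_mul, add_mul, mul_add, add_mul, add_mul, h6, h7]
  simp only [one_mul, mul_one]
  abel

/-- The induced homomorphism on the free Milnor group. -/
def psi {s : ℕ} (p : Fin s → ℕ) : FreeMilnor s →* (Module.End ℤ (ℕ → ℤ))ˣ :=
  QuotientGroup.lift _ (phi p) (by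
    change _ ≤ (phi p).ker
    apply Subgroup.normalClosure_le_normal
    rintro x ⟨i, h, rfl⟩
    exact phi_rel p i h)

theorem psi_fmk {s : ℕ} (p : Fin s → ℕ) (i : Fin s) :
    psi p (fmk i) = T (p i) (p i + 1) (by omega) := by
  change phi p (FreeGroup.of i) = _
  simp [phi]

theorem comm_T (k m : ℕ) (h : k + 1 < m) :
    ⁅T k (k + 1) (by omega), T (k + 1) m (by omega)⁆ = T k m (by omega) := by
  rw [commutatorElement_def, mul_inv_eq_iff_eq_mul, mul_inv_eq_iff_eq_mul]
  apply Units.ext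
  simp only [Units.val_mul, T]
  have e1 := E_mul_eq k (k + 1) m
  have e2 := E_mul_ne (k + 1) m k (k + 1) (by omega)
  have e3 := E_mul_ne k m k (k + 1) (by omega)
  have e4 := E_mul_ne k m (k + 1) m (by omega)
  simp only [mul_add, add_mul, e1, e2, e3, e4, one_mul, mul_one]
  abel

theorem psi_iter {s : ℕ} (p : Fin s → ℕ) (l : List (Fin s)) :
    ∀ (j : Fin s) (k : ℕ), (j :: l).map p = List.range' k (l.length + 1) →
      psi p (listIterComm (fun i : Fin s => fmk i) (j :: l)) =
        T k (k + l.length + 1) (by omega) := by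
  induction l with
  | nil =>
    intro j k h
    simp at h
    subst h
    exact psi_fmk p j
  | cons t ts ih =>
    intro j k h
    rw [List.map_cons, List.length_cons, List.range'_succ, List.cons.injEq] at h
    obtain ⟨rfl, h⟩ := h
    rw [listIterComm, map_commutatorElement, ih t _ h, psi_fmk, comm_T _ _ (by omega)]
    simp only [List.length_cons]
    congr 1
    omega

theorem T_ne_one (a b : ℕ) (h : a ≠ b) : T a b h ≠ 1 := by
  intro h1
  have h2 := congrArg (fun u : (Module.End ℤ (ℕ → ℤ))ˣ => u.val (Pi.single b 1) a) h1
  simp [T, E_apply, h] at h2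

end MilnorAux

/-- In the free Milnor group `M(F_s)`, the left-iterated commutator of a nonempty list of
pairwise distinct generators is nontrivial. -/
theorem iterComm_nodup_nontrivial (s : ℕ) (l : List (Fin s))
    (hne : l ≠ []) (hnodup : l.Nodup) :
    listIterComm (fun i : Fin s => fmk i) l ≠ 1 := by
  obtain _ | ⟨j, l⟩ := l
  · exact absurd rfl hne
  intro h
  have key := MilnorAux.psi_iter (fun i => (j :: l).idxOf i) l j 0 (by
    apply List.ext_getElem
    · simp
    · intro n h1 h2
      rw [List.getElem_map, hnodup.idxOf_getElem]
      simp)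
  rw [h, map_one] at key
  exact MilnorAux.T_ne_one _ _ _ key.symm
end

section
/- For every s ≥ 1, the free Milnor group M(F_s) is nilpotent of class exactly s: its lower central series satisfies M(F_s)^{s+1} = 1 but M(F_s)^{s} ≠ 1. -/
open scoped commutatorElement

/-- If a generator commutes with all its conjugates, its normal closure is abelian. -/
lemma commute_of_mem_normalClosure {G : Type*} [Group G] {x : G}
    (hx : ∀ h : G, Commute x (h⁻¹ * x * h)) {a : G}
    (ha : a ∈ Subgroup.normalClosure ({x} : Set G)) : Commute x a := by
  have : Subgroup.normalClosure ({x} : Set G) ≤ Subgroup.centralizer {x} := by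
    unfold Subgroup.normalClosure
    rw [Subgroup.closure_le]
    intro y hy
    obtain ⟨b, hb, hc⟩ := Group.mem_conjugatesOfSet_iff.1 hy
    rw [Set.mem_singleton_iff] at hb
    subst hb
    obtain ⟨c, rfl⟩ := isConj_iff.1 hc
    have := hx c⁻¹
    rw [inv_inv] at this
    rw [SetLike.mem_coe, Subgroup.mem_centralizer_iff]
    rintro z rfl
    exact this
  exact Subgroup.mem_centralizer_iff.1 (this ha) x rfl

lemma milnor_upper : ∀ (n : ℕ) (G : Type) [Group G] (x : Fin n → G)
    (_ : Subgroup.closure (Set.range x) = ⊤)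
    (_ : ∀ i h, Commute (x i) (h⁻¹ * x i * h)),
    Subgroup.lowerCentralSeries (⊤ : Subgroup G) n = ⊥ := by
  intro n
  induction n with
  | zero =>
    intro G _ x hgen _
    rw [Subgroup.lowerCentralSeries_zero, ← hgen]
    simp
  | succ n ih =>
    intro G _ x hgen hx
    have key : ∀ i, Subgroup.lowerCentralSeries (⊤ : Subgroup G) n ≤
        Subgroup.normalClosure ({x i} : Set G) := by
      intro i
      let q := QuotientGroup.mk' (Subgroup.normalClosure ({x i} : Set G))
      have hq : Function.Surjective q := QuotientGroup.mk'_surjective _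
      have h1 := ih (G ⧸ Subgroup.normalClosure ({x i} : Set G))
        (fun j => q (x (i.succAbove j))) ?_ ?_
      · have h2 := Subgroup.map_lowerCentralSeries (⊤ : Subgroup G) q n
        rw [Subgroup.map_top_of_surjective q hq, h1, Subgroup.map_eq_bot_iff] at h2
        rwa [QuotientGroup.ker_mk'] at h2
      · rw [eq_top_iff, ← Subgroup.map_top_of_surjective q hq, ← hgen, MonoidHom.map_closure,
          Subgroup.closure_le]
        rintro _ ⟨_, ⟨j, rfl⟩, rfl⟩
        rcases eq_or_ne j i with rfl | hj
        · have : q (x j) = 1 := by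
            rw [← MonoidHom.mem_ker, QuotientGroup.ker_mk']
            exact Subgroup.subset_normalClosure rfl
          rw [this]
          exact one_mem _
        · obtain ⟨k, rfl⟩ := Fin.exists_succAbove_eq hj
          exact Subgroup.subset_closure ⟨k, rfl⟩
      · intro j h
        obtain ⟨g, rfl⟩ := hq h
        have := (hx (i.succAbove j) g).map q
        simpa using this
    rw [Subgroup.lowerCentralSeries_succ, Subgroup.commutator_eq_bot_iff_le_centralizer]
    intro a ha
    have : (⊤ : Subgroup G) ≤ Subgroup.centralizer {a} := by
      rw [← hgen, Subgroup.closure_le]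
      rintro _ ⟨i, rfl⟩
      rw [SetLike.mem_coe, Subgroup.mem_centralizer_iff]
      rintro z rfl
      exact (commute_of_mem_normalClosure (hx i) (key i ha)).symm
    rw [Subgroup.mem_centralizer_iff]
    intro g hg
    exact (Subgroup.mem_centralizer_iff.1 (this hg) a rfl).symm

/-- The unit `1 + e` for `e` of square zero. -/
def oneAddUnit {R : Type*} [Ring R] (e : R) (h : e * e = 0) : Rˣ where
  val := 1 + e
  inv := 1 - e
  val_inv := by simp [mul_sub, add_mul, h]
  inv_val := by simp [mul_add, sub_mul, h]

lemma oneAddUnit_commutator {R : Type*} [Ring R] (e f g : R) (he : e * e = 0) (hf : f * f = 0)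
    (hg : g * g = 0) (hef : e * f = g) (hfe : f * e = 0) :
    ⁅oneAddUnit e he, oneAddUnit f hf⁆ = oneAddUnit g hg := by
  rw [commutatorElement_def, mul_inv_eq_iff_eq_mul, mul_inv_eq_iff_eq_mul]
  ext
  have h1 : g * e = 0 := by rw [← hef, mul_assoc, hfe, mul_zero]
  have h2 : g * f = 0 := by rw [← hef, mul_assoc, hf, mul_zero]
  simp only [oneAddUnit, Units.val_mul, mul_add, add_mul, hef, hfe, h1, h2, one_mul, mul_one,
    zero_mul]
  abel

lemma oneAddUnit_commute {R : Type*} [Ring R] (e : R) (he : e * e = 0) (h : Rˣ)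
    (h1 : e * (h : R) * e = 0) (h2 : e * (h⁻¹ : Rˣ) * e = 0) :
    Commute (oneAddUnit e he) (h⁻¹ * oneAddUnit e he * h) := by
  have hk : ((h⁻¹ * oneAddUnit e he * h : Rˣ) : R) = 1 + (h⁻¹ : Rˣ) * e * h := by
    simp [oneAddUnit, mul_add, add_mul]
  have h3 : e * (((h⁻¹ : Rˣ) : R) * e * h) = 0 := by
    rw [← mul_assoc, ← mul_assoc, h2, zero_mul]
  have h4 : ((h⁻¹ : Rˣ) : R) * e * h * e = 0 := by
    rw [mul_assoc, mul_assoc, ← mul_assoc e, h1, mul_zero]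
  refine Units.ext ?_
  rw [Units.val_mul, Units.val_mul (h⁻¹ * oneAddUnit e he * h), hk]
  simp only [oneAddUnit, mul_add, add_mul, h3, h4, one_mul, mul_one]
  abel

lemma single_sq {n : ℕ} {i j : Fin n} (h : i < j) :
    (Matrix.single i j 1 : Matrix (Fin n) (Fin n) ℤ) * Matrix.single i j 1 = 0 :=
  Matrix.single_mul_single_of_ne (h := h.ne') ..

/-- Elementary unipotent matrices. -/
def elemUnit {n : ℕ} (i j : Fin n) (h : i < j) : (Matrix (Fin n) (Fin n) ℤ)ˣ :=
  oneAddUnit (Matrix.single i j 1) (single_sq h)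

lemma elemUnit_commutator {n : ℕ} (i j k : Fin n) (hij : i < j) (hjk : j < k) :
    ⁅elemUnit i j hij, elemUnit j k hjk⁆ = elemUnit i k (hij.trans hjk) :=
  oneAddUnit_commutator _ _ _ _ _ _ (by simp)
    (Matrix.single_mul_single_of_ne (h := (hij.trans hjk).ne') ..)

/-- The representation of the free group by unitriangular matrices. -/
def uniRep (s : ℕ) : FreeGroup (Fin s) →* (Matrix (Fin (s + 1)) (Fin (s + 1)) ℤ)ˣ :=
  FreeGroup.lift fun i => elemUnit i.castSucc i.succ i.castSucc_lt_succ

lemma uniRep_triangular (s : ℕ) (w : FreeGroup (Fin s)) :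
    Matrix.BlockTriangular (uniRep s w : Matrix (Fin (s + 1)) (Fin (s + 1)) ℤ) id := by
  induction w using FreeGroup.induction_on with
  | C1 => simpa using Matrix.blockTriangular_one
  | of i =>
    simp only [uniRep, FreeGroup.lift_apply_of]
    exact Matrix.blockTriangular_one.add
      (Matrix.blockTriangular_single (b := id) i.castSucc_lt_succ.le 1)
  | inv_of i _ =>
    simp only [uniRep, map_inv, FreeGroup.lift_apply_of]
    exact Matrix.blockTriangular_one.sub
      (Matrix.blockTriangular_single (b := id) i.castSucc_lt_succ.le 1)
  | mul a b ha hb =>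
    rw [map_mul, Units.val_mul]
    exact ha.mul hb

lemma uniRep_relators (s : ℕ) :
    Subgroup.normalClosure (milnorRelators fun i : Fin s => FreeGroup.of i) ≤
      (uniRep s).ker := by
  apply Subgroup.normalClosure_le_normal
  rintro _ ⟨i, h, rfl⟩
  rw [SetLike.mem_coe, MonoidHom.mem_ker, map_commutatorElement, commutatorElement_eq_one_iff_commute,
    map_mul, map_mul, map_inv]
  have hi : uniRep s (FreeGroup.of i) = elemUnit i.castSucc i.succ i.castSucc_lt_succ := by
    simp [uniRep]
  rw [hi]
  apply oneAddUnit_commute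
  · rw [Matrix.single_mul_mul_single, uniRep_triangular s h (i := i.succ) (j := i.castSucc)
      i.castSucc_lt_succ]
    simp
  · rw [← map_inv, Matrix.single_mul_mul_single,
      uniRep_triangular s h⁻¹ (i := i.succ) (j := i.castSucc) i.castSucc_lt_succ]
    simp

/-- The representation of the free Milnor group. -/
def milnorRep (s : ℕ) : FreeMilnor s →* (Matrix (Fin (s + 1)) (Fin (s + 1)) ℤ)ˣ :=
  QuotientGroup.lift _ (uniRep s) (uniRep_relators s)

lemma milnorRep_fmk (s : ℕ) (i : Fin s) :
    milnorRep s (fmk i) = elemUnit i.castSucc i.succ i.castSucc_lt_succ := by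
  show uniRep s (FreeGroup.of i) = _
  simp [uniRep]

lemma milnor_lower (t : ℕ) (m : ℕ) (hm : m ≤ t) :
    ∃ c ∈ Subgroup.lowerCentralSeries (⊤ : Subgroup (FreeMilnor (t + 1))) m,
      milnorRep (t + 1) c = elemUnit ⟨t - m, by omega⟩ (Fin.last (t + 1))
        (by rw [Fin.lt_def]; simp only [Fin.val_last]; omega) := by
  induction m with
  | zero =>
    refine ⟨fmk (Fin.last t), Subgroup.mem_top _, ?_⟩
    rw [milnorRep_fmk]
    rfl
  | succ m ih =>
    obtain ⟨c, hc, hr⟩ := ih (by omega)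
    have hlt : t - (m + 1) < t + 1 := by omega
    refine ⟨⁅fmk ⟨t - (m + 1), hlt⟩, c⁆, ?_, ?_⟩
    · rw [Subgroup.lowerCentralSeries_succ, Subgroup.commutator_comm]
      exact Subgroup.commutator_mem_commutator (Subgroup.mem_top _) hc
    · rw [map_commutatorElement, milnorRep_fmk, hr]
      have : (⟨t - m, by omega⟩ : Fin (t + 1 + 1)) =
          (⟨t - (m + 1), hlt⟩ : Fin (t + 1)).succ := by
        ext; simp only [Fin.val_succ]; omega
      simp only [this]
      exact elemUnit_commutator _ _ _ _ _

/-- For `s ≥ 1`, the free Milnor group `M(F_s)` is nilpotent of class exactly `s`: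
`M(F_s)^{s+1} = 1` but `M(F_s)^s ≠ 1`.  (Recall `Γ^{m+1}` is the `m`-th term of
Mathlib's `lowerCentralSeries`.) -/
theorem freeMilnor_nilpotency_class (s : ℕ) (hs : 1 ≤ s) :
    Subgroup.lowerCentralSeries (⊤ : Subgroup (FreeMilnor s)) s = ⊥ ∧
    Subgroup.lowerCentralSeries (⊤ : Subgroup (FreeMilnor s)) (s - 1) ≠ ⊥ := by
  constructor
  · have hq : Function.Surjective (milnorQuot (fun j : Fin s => FreeGroup.of j)) :=
      QuotientGroup.mk'_surjective _
    apply milnor_upper s (FreeMilnor s) fmk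
    · rw [← Subgroup.map_top_of_surjective _ hq, ← FreeGroup.closure_range_of,
        MonoidHom.map_closure, ← Set.range_comp]
      rfl
    · intro i h
      obtain ⟨g, rfl⟩ := hq h
      rw [← commutatorElement_eq_one_iff_commute]
      have : milnorQuot (fun j : Fin s => FreeGroup.of j)
          ⁅FreeGroup.of i, g⁻¹ * FreeGroup.of i * g⁆ = 1 := by
        rw [← MonoidHom.mem_ker, QuotientGroup.ker_mk']
        exact Subgroup.subset_normalClosure ⟨i, g, rfl⟩
      rw [map_commutatorElement, map_mul, map_mul, map_inv] at this
      exact this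
  · obtain ⟨t, rfl⟩ : ∃ t, s = t + 1 := ⟨s - 1, by omega⟩
    intro hbot
    obtain ⟨c, hc, hr⟩ := milnor_lower t t le_rfl
    rw [Nat.add_sub_cancel] at hbot
    rw [hbot, Subgroup.mem_bot] at hc
    rw [hc, map_one] at hr
    have h1 := congrArg (fun u : (Matrix (Fin (t + 1 + 1)) (Fin (t + 1 + 1)) ℤ)ˣ =>
      (u : Matrix (Fin (t + 1 + 1)) (Fin (t + 1 + 1)) ℤ) ⟨t - t, by omega⟩ (Fin.last (t + 1))) hr
    simp [elemUnit, oneAddUnit] at h1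
end

section
/- Let g ≥ 1 and consider the free Milnor group M(F_{2g}) on generators x_1, …, x_{2g}. Then the image of the surface relation ∏_{i=1}^{g} [x_{2i−1}, x_{2i}] does not lie in the third term M(F_{2g})^3 = [M(F_{2g}), [M(F_{2g}), M(F_{2g})]] of the lower central series of M(F_{2g}). -/
open scoped commutatorElement

theorem dihedral_milnor (x h : DihedralGroup 4) : ⁅x, h⁻¹ * x * h⁆ = 1 := by
  revert x h; decide

theorem dihedral_class_two (x y z : DihedralGroup 4) : ⁅⁅x, y⁆, z⁆ = 1 := by
  revert x y z; decide

theorem dihedral_lcs :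
    Subgroup.lowerCentralSeries (⊤ : Subgroup (DihedralGroup 4)) 2 = ⊥ := by
  rw [eq_bot_iff]
  change ⁅⁅(⊤ : Subgroup (DihedralGroup 4)), ⊤⁆, ⊤⁆ ≤ ⊥
  rw [Subgroup.commutator_le]
  intro p hp q _
  have hc : ⁅(⊤ : Subgroup (DihedralGroup 4)), ⊤⁆ ≤ Subgroup.center (DihedralGroup 4) := by
    rw [Subgroup.commutator_le]
    intro x _ y _
    rw [Subgroup.mem_center_iff]
    intro z
    exact (commutatorElement_eq_one_iff_mul_comm.mp (dihedral_class_two x y z)).symm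
  have := Subgroup.mem_center_iff.mp (hc hp) q
  rw [Subgroup.mem_bot]
  exact commutatorElement_eq_one_iff_mul_comm.mpr this.symm

/-- Images of the generators in the dihedral group of order 8. -/
def genImage (s : ℕ) (i : Fin s) : DihedralGroup 4 :=
  if i.val = 0 then DihedralGroup.sr 0 else if i.val = 1 then DihedralGroup.r 1 else 1

/-- The induced homomorphism from the free Milnor group. -/
def toDihedral (s : ℕ) : FreeMilnor s →* DihedralGroup 4 :=
  QuotientGroup.lift _ (FreeGroup.lift (genImage s)) (by
    intro x hx
    have : Subgroup.normalClosure (milnorRelators (fun i : Fin s => FreeGroup.of i)) ≤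
        (FreeGroup.lift (genImage s)).ker := by
      apply Subgroup.normalClosure_le_normal
      rintro _ ⟨i, h, rfl⟩
      rw [SetLike.mem_coe, MonoidHom.mem_ker, map_commutatorElement, map_mul, map_mul, map_inv]
      exact dihedral_milnor _ _
    exact this hx)

theorem toDihedral_fmk (s : ℕ) (i : Fin s) : toDihedral s (fmk i) = genImage s i := by
  change FreeGroup.lift (genImage s) (FreeGroup.of i) = _
  simp

/-- In the free Milnor group `M(F_{2g})` with `g ≥ 1`, the image of the surface relation
`∏_{i=1}^{g} [x_{2i-1}, x_{2i}]` does not lie in the third term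
`M(F_{2g})^3 = lowerCentralSeries (M(F_{2g})) 2` of the lower central series. -/
theorem surface_relation_not_in_third_lcs (g : ℕ) (hg : 1 ≤ g) :
    (List.ofFn fun i : Fin g =>
        ⁅fmk (⟨2 * i.val, by have := i.isLt; omega⟩ : Fin (2 * g)),
         fmk (⟨2 * i.val + 1, by have := i.isLt; omega⟩ : Fin (2 * g))⁆).prod ∉
      Subgroup.lowerCentralSeries (⊤ : Subgroup (FreeMilnor (2 * g))) 2 := by
  intro hmem
  have h1 := Subgroup.mem_map_of_mem (toDihedral (2 * g)) hmem
  have h2 := (Subgroup.lowerCentralSeries_mono 2 le_top :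
    Subgroup.lowerCentralSeries ((⊤ : Subgroup (FreeMilnor (2 * g))).map (toDihedral (2 * g))) 2
      ≤ Subgroup.lowerCentralSeries ⊤ 2)
  beta_reduce at h2
  rw [← Subgroup.map_lowerCentralSeries, dihedral_lcs] at h2
  have h3 := Subgroup.mem_bot.mp (h2 h1)
  obtain ⟨n, rfl⟩ : ∃ n, g = n + 1 := ⟨g - 1, by omega⟩
  rw [map_list_prod, List.map_ofFn, List.ofFn_succ, List.prod_cons, List.prod_eq_one (l := List.ofFn _)] at h3
  · simp only [Function.comp, map_commutatorElement, toDihedral_fmk, genImage] at h3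
    revert h3
    simp
    decide
  · intro x hx
    obtain ⟨i, rfl⟩ := (List.mem_ofFn' _ _).mp hx
    simp [map_commutatorElement, toDihedral_fmk, genImage]
end
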